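/- arXiv:math/0510044 — 3 statements merged into one kernel-verified Lean document; each statement's English description precedes it below -/
import Mathlib

section
/- If a permutation class C contains only finitely many simple permutations, then the generating function f(x) = Σ_{n≥0} c_n x^n, where c_n is the number of permutations of length n in C, is algebraic over ℚ(x); that is, there is a nonzero bivariate polynomial P with rational coefficients such that P(x, f(x)) = 0 as formal power series. -/
/-- A permutation of arbitrary length: a length `n` together with a
bijection of `Fin n` (0-indexed positions and values). -/
abbrev PermAny : Type := Σ n : ℕ, Equiv.Perm (Fin n)

/-- `β` is contained as a pattern in `π`. -/
def ContainsPat {k n : ℕ} (β : Equiv.Perm (Fin k)) (π : Equiv.Perm (Fin n)) : Prop :=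
  ∃ f : Fin k → Fin n, StrictMono f ∧ ∀ a b : Fin k, β a < β b ↔ π (f a) < π (f b)

/-- `Av(B)`: the permutations avoiding every member of `B`. -/
def AvSet (B : Set PermAny) : Set PermAny :=
  {p | ∀ b ∈ B, ¬ ContainsPat b.2 p.2}

/-- A permutation class: closed downwards under pattern containment. -/
def IsPermClass (C : Set PermAny) : Prop :=
  ∀ p ∈ C, ∀ q : PermAny, ContainsPat q.2 p.2 → q ∈ C

/-- The positions `a,…,b` form an interval of `π`: the corresponding values
form a set of consecutive integers. -/
def IsIntervalAt {n : ℕ} (π : Equiv.Perm (Fin n)) (a b : Fin n) : Prop :=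
  a ≤ b ∧ ∃ c : ℕ,
    (Finset.Icc a b).image (fun i => (π i : ℕ)) = Finset.Icc c (c + ((b : ℕ) - (a : ℕ)))

/-- A permutation is simple when all of its intervals are trivial. -/
def IsSimplePerm {n : ℕ} (π : Equiv.Perm (Fin n)) : Prop :=
  ∀ a b : Fin n, IsIntervalAt π a b → a = b ∨ ((a : ℕ) = 0 ∧ (b : ℕ) = n - 1)

/-- `Z(B;π;g)`: the set of `B`-avoiding permutations of length `k + ‖g‖` whose
`k` smallest values occupy the positions prescribed by the gap vector `g`
and form the pattern `π`.  (0-indexed: entry `π r` sits at position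
`g 0 + ⋯ + g r + r`.) -/
def ZSet (B : Set PermAny) {k : ℕ} (π : Equiv.Perm (Fin k)) (g : Fin (k + 1) → ℕ) :
    Set (Equiv.Perm (Fin (k + ∑ j, g j))) :=
  {p | (⟨k + ∑ j, g j, p⟩ : PermAny) ∈ AvSet B ∧
    ∀ r : Fin k, ∀ i : Fin (k + ∑ j, g j),
      (i : ℕ) = (∑ j ∈ Finset.univ.filter fun j : Fin (k + 1) => (j : ℕ) ≤ (r : ℕ), g j)
          + (r : ℕ) →
      (p i : ℕ) = (π r : ℕ)}

/-- `J(π)`: the set of gap positions `j` such that `Z(B;π;g)` is empty whenever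
`g j > 0`. -/
def JSet (B : Set PermAny) {k : ℕ} (π : Equiv.Perm (Fin k)) : Set (Fin (k + 1)) :=
  {j | ∀ g : Fin (k + 1) → ℕ, 0 < g j → ZSet B π g = ∅}

/-- `d_r(π)`: delete the entry at position `r` from `π` and standardize. -/
def delEntry {k : ℕ} (π : Equiv.Perm (Fin (k + 1))) (r : Fin (k + 1)) : Equiv.Perm (Fin k) :=
  Equiv.removeNone ((finSuccEquiv' r).symm.trans (π.trans (finSuccEquiv' (π r))))

/-- `d_r(g)`: merge the gaps on either side of position `r`. -/
def delGap {k : ℕ} (g : Fin (k + 2) → ℕ) (r : Fin (k + 1)) : Fin (k + 1) → ℕ :=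
  fun j =>
    if (j : ℕ) < (r : ℕ) then g (Fin.castSucc j)
    else if (j : ℕ) = (r : ℕ) then g (Fin.castSucc j) + g j.succ
    else g j.succ

/-- The entry `π r` is ES-reducible for `π` with respect to `B`
(Zeilberger's original notion). -/
def ESRed (B : Set PermAny) {k : ℕ} (π : Equiv.Perm (Fin (k + 1))) (r : Fin (k + 1)) : Prop :=
  ∀ g : Fin (k + 2) → ℕ, (∀ j ∈ JSet B π, g j = 0) →
    (ZSet B π g).ncard = (ZSet B (delEntry π r) (delGap g r)).ncard

/-- The entry `π r` is ES⁺-reducible for `π` with respect to `B`. -/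
def ESPlusRed (B : Set PermAny) {k : ℕ} (π : Equiv.Perm (Fin (k + 1))) (r : Fin (k + 1)) : Prop :=
  ∀ g : Fin (k + 2) → ℕ, (ZSet B π g).Nonempty →
    (ZSet B π g).ncard = (ZSet B (delEntry π r) (delGap g r)).ncard

/-- `G_r(π)`: the largest lower order ideal of gap vectors `g` such that for all
`h ≤ g`, either `Z(B;π;h)` is nonempty or `Z(B;d_r(π);d_r(h))` is empty. -/
def GrSet (B : Set PermAny) {k : ℕ} (π : Equiv.Perm (Fin (k + 1))) (r : Fin (k + 1)) :
    Set (Fin (k + 2) → ℕ) :=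
  {g | ∀ h : Fin (k + 2) → ℕ, h ≤ g →
    (ZSet B π h).Nonempty ∨ ZSet B (delEntry π r) (delGap h r) = ∅}

namespace AA

/-- containment on `PermAny` -/
def cle (p q : PermAny) : Prop := ContainsPat p.2 q.2

theorem cle_refl (p : PermAny) : cle p p := ⟨id, strictMono_id, fun _ _ => Iff.rfl⟩

theorem cle_trans {p q r : PermAny} (h1 : cle p q) (h2 : cle q r) : cle p r := by
  obtain ⟨f, hf, hf'⟩ := h1
  obtain ⟨g, hg, hg'⟩ := h2
  exact ⟨g ∘ f, hg.comp hf, fun a b => (hf' a b).trans (hg' _ _)⟩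

theorem exists_perm {ι L M : Type*} [Fintype ι] [LinearOrder L] [LinearOrder M]
    (x : ι → L) (hx : Function.Injective x) (y : ι → M) (hy : Function.Injective y) :
    ∃ π : PermAny, ∃ e : ι ≃ Fin π.1, (∀ a b, e a < e b ↔ x a < x b) ∧
      (∀ a b, π.2 (e a) < π.2 (e b) ↔ y a < y b) := by
  have key : ∀ {L : Type _} [LinearOrder L] (x : ι → L) (hx : Function.Injective x),
      ∃ e : ι ≃ Fin (Fintype.card ι), ∀ a b, e a < e b ↔ x a < x b := by
    intro L _ x hx
    let _ : LinearOrder ι := LinearOrder.lift' x hx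
    let e := (Fintype.orderIsoFinOfCardEq ι rfl).symm
    exact ⟨e.toEquiv, fun a b => e.lt_iff_lt⟩
  have key2 : ∀ {L : Type _} [LinearOrder L] (x : ι → L) (hx : Function.Injective x),
      ∃ e : ι ≃ Fin (Fintype.card ι), ∀ a b, e a < e b ↔ x a < x b := by
    intro L _ x hx
    let _ : LinearOrder ι := LinearOrder.lift' x hx
    let e := (Fintype.orderIsoFinOfCardEq ι rfl).symm
    exact ⟨e.toEquiv, fun a b => e.lt_iff_lt⟩
  obtain ⟨ex, hex⟩ := key x hx
  obtain ⟨ey, hey⟩ := key2 y hy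
  exact ⟨⟨_, ex.symm.trans ey⟩, ex, hex, fun a b => by simpa using hey a b⟩

theorem equiv_fin_eq_refl {n : ℕ} (e : Fin n ≃ Fin n) (h : ∀ a b, e a < e b ↔ a < b) :
    e = Equiv.refl _ := by
  have h1 : StrictMono e := fun a b hab => (h a b).2 hab
  ext a
  have : (h1.orderIsoOfSurjective _ e.surjective) = OrderIso.refl (Fin n) := Subsingleton.elim _ _
  have h2 := congrArg (fun f : Fin n ≃o Fin n => (f a : ℕ)) this
  simpa using h2

theorem perm_ext {π ρ : PermAny} (e : Fin π.1 ≃ Fin ρ.1) (h1 : ∀ a b, e a < e b ↔ a < b)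
    (h2 : ∀ a b, ρ.2 (e a) < ρ.2 (e b) ↔ π.2 a < π.2 b) : π = ρ := by
  obtain ⟨n, π⟩ := π
  obtain ⟨m, ρ⟩ := ρ
  obtain rfl : n = m := by simpa using Fintype.card_congr e
  obtain rfl := equiv_fin_eq_refl e h1
  have := equiv_fin_eq_refl (π.symm.trans ρ) (fun a b => by
    have := h2 (π.symm a) (π.symm b)
    simpa using this)
  congr 1
  ext a
  have h3 := congrArg (fun e : Fin n ≃ Fin n => (e (π a) : ℕ)) this
  simpa using h3.symm

/-- `π` is the inflation of `σ` by the `α k`, through the identification `e`. -/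
structure InflEq (π σ : PermAny) (α : Fin σ.1 → PermAny)
    (e : (Σ k, Fin (α k).1) ≃ Fin π.1) : Prop where
  pos : ∀ a b, e a < e b ↔ a.1 < b.1 ∨ (a.1 = b.1 ∧ (a.2 : ℕ) < b.2)
  val : ∀ a b, π.2 (e a) < π.2 (e b) ↔
    σ.2 a.1 < σ.2 b.1 ∨ (a.1 = b.1 ∧ ((α a.1).2 a.2 : ℕ) < (α b.1).2 b.2)

theorem exists_infl (σ : PermAny) (α : Fin σ.1 → PermAny) : ∃ π e, InflEq π σ α e := by
  obtain ⟨π, e, h1, h2⟩ := exists_perm (ι := Σ k, Fin (α k).1)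
    (fun a => toLex (a.1, (a.2 : ℕ))) (by
      rintro ⟨k, i⟩ ⟨l, j⟩ h
      simp only [EmbeddingLike.apply_eq_iff_eq, Prod.mk.injEq] at h
      obtain ⟨rfl, h⟩ := h
      rw [Fin.ext h])
    (fun a => toLex (σ.2 a.1, ((α a.1).2 a.2 : ℕ))) (by
      rintro ⟨k, i⟩ ⟨l, j⟩ h
      simp only [EmbeddingLike.apply_eq_iff_eq, Prod.mk.injEq] at h
      obtain ⟨rfl, h⟩ := h
      rw [(α k).2.injective (Fin.ext h)])
  refine ⟨π, e, ⟨fun a b => ?_, fun a b => ?_⟩⟩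
  · rw [h1, Prod.Lex.toLex_lt_toLex]
  · rw [h2, Prod.Lex.toLex_lt_toLex]; simp

/-- The inflation of `σ` by `α`. -/
noncomputable def infl (σ : PermAny) (α : Fin σ.1 → PermAny) : PermAny := (exists_infl σ α).choose

/-- The carrier identification of the inflation. -/
noncomputable def inflE (σ : PermAny) (α : Fin σ.1 → PermAny) :
    (Σ k, Fin (α k).1) ≃ Fin (infl σ α).1 := (exists_infl σ α).choose_spec.choose

theorem infl_spec (σ : PermAny) (α : Fin σ.1 → PermAny) : InflEq (infl σ α) σ α (inflE σ α) :=
  (exists_infl σ α).choose_spec.choose_spec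

theorem InflEq.unique {π σ : PermAny} {α : Fin σ.1 → PermAny}
    {e : (Σ k, Fin (α k).1) ≃ Fin π.1} (h : InflEq π σ α e) : π = infl σ α := by
  have h' := infl_spec σ α
  refine perm_ext (e.symm.trans (inflE σ α)) (fun a b => ?_) (fun a b => ?_)
  · obtain ⟨a, rfl⟩ := e.surjective a
    obtain ⟨b, rfl⟩ := e.surjective b
    simp [h.pos, h'.pos]
  · obtain ⟨a, rfl⟩ := e.surjective a
    obtain ⟨b, rfl⟩ := e.surjective b
    simp [h.val, h'.val]

theorem infl_size (σ : PermAny) (α : Fin σ.1 → PermAny) : (infl σ α).1 = ∑ k, (α k).1 := by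
  simpa using (Fintype.card_congr (inflE σ α)).symm

theorem infl_mono (σ : PermAny) {α β : Fin σ.1 → PermAny} (h : ∀ k, cle (α k) (β k)) :
    cle (infl σ α) (infl σ β) := by
  choose f hf hf' using h
  have h1 := infl_spec σ α
  have h2 := infl_spec σ β
  let G : (Σ k, Fin (α k).1) → Σ k, Fin (β k).1 := fun a => ⟨a.1, f a.1 a.2⟩
  refine ⟨fun a => inflE σ β (G ((inflE σ α).symm a)), fun a b => ?_, fun a b => ?_⟩
  · obtain ⟨⟨k, a⟩, rfl⟩ := (inflE σ α).surjective a
    obtain ⟨⟨l, b⟩, rfl⟩ := (inflE σ α).surjective b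
    beta_reduce
    rw [Equiv.symm_apply_apply, Equiv.symm_apply_apply, h1.pos, h2.pos]
    rintro (h | ⟨rfl, h⟩)
    · exact Or.inl h
    · exact Or.inr ⟨rfl, hf _ h⟩
  · obtain ⟨⟨k, a⟩, rfl⟩ := (inflE σ α).surjective a
    obtain ⟨⟨l, b⟩, rfl⟩ := (inflE σ α).surjective b
    beta_reduce
    rw [Equiv.symm_apply_apply, Equiv.symm_apply_apply, h1.val, h2.val]
    refine or_congr Iff.rfl ⟨?_, ?_⟩
    · rintro ⟨rfl, h⟩
      exact ⟨rfl, (hf' _ _ _).1 h⟩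
    · rintro ⟨rfl, h⟩
      exact ⟨rfl, (hf' _ _ _).2 h⟩

theorem cle_infl (σ : PermAny) (α : Fin σ.1 → PermAny) (k : Fin σ.1) : cle (α k) (infl σ α) := by
  have h1 := infl_spec σ α
  refine ⟨fun i => inflE σ α ⟨k, i⟩, fun a b hab => ?_, fun a b => ?_⟩
  · rw [h1.pos]; exact Or.inr ⟨rfl, hab⟩
  · rw [h1.val]; simp

theorem cle_infl' (σ : PermAny) (α : Fin σ.1 → PermAny) (h : ∀ k, 0 < (α k).1) :
    cle σ (infl σ α) := by
  have h1 := infl_spec σ α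
  refine ⟨fun k => inflE σ α ⟨k, ⟨0, h k⟩⟩, fun a b hab => ?_, fun a b => ?_⟩
  · rw [h1.pos]; exact Or.inl hab
  · rw [h1.val]
    constructor
    · exact Or.inl
    · rintro (h | ⟨rfl, h⟩)
      · exact h
      · simp at h

/-- Block maps. -/
def Blk (π σ : PermAny) (p : Fin π.1 → Fin σ.1) : Prop :=
  Function.Surjective p ∧ ∀ a b, p a ≠ p b →
    ((a < b ↔ p a < p b) ∧ (π.2 a < π.2 b ↔ σ.2 (p a) < σ.2 (p b)))

def IsInfl (σ π : PermAny) : Prop := ∃ p, Blk π σ p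

theorem InflEq.blk {π σ : PermAny} {α : Fin σ.1 → PermAny}
    {e : (Σ k, Fin (α k).1) ≃ Fin π.1} (h : InflEq π σ α e) (hα : ∀ k, 0 < (α k).1) :
    Blk π σ (fun a => (e.symm a).1) := by
  refine ⟨fun k => ⟨e ⟨k, ⟨0, hα k⟩⟩, by simp⟩, fun a b hab => ?_⟩
  obtain ⟨a, rfl⟩ := e.surjective a
  obtain ⟨b, rfl⟩ := e.surjective b
  simp only [Equiv.symm_apply_apply] at hab ⊢
  rw [h.pos, h.val]
  simp [hab]

theorem Blk.exists_infl {π σ : PermAny} {p : Fin π.1 → Fin σ.1} (h : Blk π σ p) :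
    ∃ (α : Fin σ.1 → PermAny) (e : (Σ k, Fin (α k).1) ≃ Fin π.1), (∀ k, 0 < (α k).1) ∧
      InflEq π σ α e ∧ ∀ a, p (e a) = a.1 := by
  have := fun k => exists_perm (ι := {a // p a = k}) (fun a => a.1) Subtype.val_injective
    (fun a => π.2 a.1) (fun a b hab => Subtype.ext (π.2.injective hab))
  choose α e he1 he2 using this
  let E : (Σ k, Fin (α k).1) ≃ Fin π.1 :=
    (Equiv.sigmaCongrRight (fun k => (e k).symm)).trans (Equiv.sigmaFiberEquiv p)
  have hE : ∀ a, p (E a) = a.1 := fun a => ((e a.1).symm a.2).2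
  have hE' : ∀ k i, E ⟨k, i⟩ = ((e k).symm i).1 := fun _ _ => rfl
  refine ⟨α, E, fun k => ?_, ⟨?_, ?_⟩, hE⟩
  · obtain ⟨a, ha⟩ := h.1 k
    exact (e k ⟨a, ha⟩).pos
  · rintro ⟨k, i⟩ ⟨l, j⟩
    by_cases hkl : k = l
    · subst hkl
      have := he1 k ((e k).symm i) ((e k).symm j)
      simp only [Equiv.apply_symm_apply] at this
      rw [hE', hE', ← this]
      simp
    · have := (h.2 (E ⟨k, i⟩) (E ⟨l, j⟩) (by rw [hE, hE]; exact hkl)).1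
      rw [this, hE, hE]; simp [hkl]
  · rintro ⟨k, i⟩ ⟨l, j⟩
    by_cases hkl : k = l
    · subst hkl
      have := he2 k ((e k).symm i) ((e k).symm j)
      simp only [Equiv.apply_symm_apply] at this
      rw [hE', hE', ← this]
      simp
    · have := (h.2 (E ⟨k, i⟩) (E ⟨l, j⟩) (by rw [hE, hE]; exact hkl)).2
      rw [this, hE, hE]; simp [hkl]

end AA

namespace AA

/-- A set of entries which no outside entry separates, in position or value. -/
def IsMod {n : ℕ} (σ : Equiv.Perm (Fin n)) (s : Finset (Fin n)) : Prop :=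
  ∀ k, k ∉ s → ((∀ j ∈ s, j < k) ∨ (∀ j ∈ s, k < j)) ∧
    ((∀ j ∈ s, σ j < σ k) ∨ (∀ j ∈ s, σ k < σ j))

theorem simple_mod {n : ℕ} {σ : Equiv.Perm (Fin n)} (h : IsSimplePerm σ) {s : Finset (Fin n)}
    (hne : s.Nonempty) (hs : IsMod σ s) : s.card = 1 ∨ s = Finset.univ := by
  set a := s.min' hne with ha
  set b := s.max' hne with hb
  have has : a ∈ s := s.min'_mem hne
  have hbs : b ∈ s := s.max'_mem hne
  have hsI : s = Finset.Icc a b := by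
    ext k
    rw [Finset.mem_Icc]
    refine ⟨fun hk => ⟨s.min'_le _ hk, s.le_max' _ hk⟩, fun hk => ?_⟩
    by_contra hks
    rcases (hs k hks).1 with h1 | h1
    · exact absurd (h1 b hbs) (not_lt.2 hk.2)
    · exact absurd (h1 a has) (not_lt.2 hk.1)
  have hab : a ≤ b := s.min'_le _ hbs
  set v := s.image (fun i => (σ i : ℕ)) with hv
  have hvne : v.Nonempty := hne.image _
  obtain ⟨i, his, hi⟩ := Finset.mem_image.1 (v.min'_mem hvne)
  obtain ⟨j, hjs, hj⟩ := Finset.mem_image.1 (v.max'_mem hvne)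
  set c := v.min' hvne
  set d := v.max' hvne
  have hvI : v = Finset.Icc c d := by
    ext x
    rw [Finset.mem_Icc]
    refine ⟨fun hk => ⟨v.min'_le _ hk, v.le_max' _ hk⟩, fun hk => ?_⟩
    have hx : x < n := by have := (σ j).2; omega
    by_contra hxv
    have hk' : σ.symm ⟨x, hx⟩ ∉ s := fun hc => hxv (Finset.mem_image.2 ⟨_, hc, by simp⟩)
    rcases (hs _ hk').2 with h1 | h1
    · have := h1 j hjs
      rw [Equiv.apply_symm_apply, Fin.lt_def] at this
      simp at this; omega
    · have := h1 i his
      rw [Equiv.apply_symm_apply, Fin.lt_def] at this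
      simp at this; omega
  have hcard : v.card = s.card :=
    Finset.card_image_of_injective _ (fun x y hxy => σ.injective (Fin.ext hxy))
  have hcd : c ≤ d := v.min'_le _ (v.max'_mem hvne)
  have hIvl : IsIntervalAt σ a b := by
    refine ⟨hab, c, ?_⟩
    rw [← hsI, ← hv, hvI]
    rw [hvI, hsI, Nat.card_Icc, Fin.card_Icc] at hcard
    rw [Fin.le_def] at hab
    congr 1
    omega
  rcases h a b hIvl with h1 | ⟨h1, h2⟩
  · left; rw [hsI, h1]; simp
  · right
    rw [hsI]
    ext k
    simp only [Finset.mem_Icc, Finset.mem_univ, iff_true, Fin.le_def]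
    have := k.2
    omega

theorem not_simple_mod {n : ℕ} {σ : Equiv.Perm (Fin n)} (h : ¬ IsSimplePerm σ) :
    ∃ s, IsMod σ s ∧ 2 ≤ s.card ∧ s ≠ Finset.univ := by
  unfold IsSimplePerm at h
  push Not at h
  obtain ⟨a, b, ⟨hab, c, hc⟩, hne, hu⟩ := h
  have hlt : a < b := lt_of_le_of_ne hab hne
  rw [Fin.lt_def] at hlt
  refine ⟨Finset.Icc a b, fun k hk => ⟨?_, ?_⟩, ?_, fun he => ?_⟩
  · rw [Finset.mem_Icc, not_and_or, not_le, not_le] at hk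
    rcases hk with hk | hk
    · exact Or.inr fun j hj => lt_of_lt_of_le hk (Finset.mem_Icc.1 hj).1
    · exact Or.inl fun j hj => lt_of_le_of_lt (Finset.mem_Icc.1 hj).2 hk
  · have h1 : (σ k : ℕ) ∉ Finset.Icc c (c + ((b : ℕ) - a)) := by
      rw [← hc, Finset.mem_image]
      rintro ⟨j, hj, hjk⟩
      exact hk (by rwa [← σ.injective (Fin.ext hjk)])
    have h2 : ∀ j ∈ Finset.Icc a b, (σ j : ℕ) ∈ Finset.Icc c (c + ((b : ℕ) - a)) := by
      intro j hj
      rw [← hc]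
      exact Finset.mem_image_of_mem _ hj
    simp only [Finset.mem_Icc, not_and_or, not_le] at h1 h2
    rcases h1 with h1 | h1
    · exact Or.inr fun j hj => by
        have := h2 j (Finset.mem_Icc.1 hj)
        rw [Fin.lt_def]; omega
    · exact Or.inl fun j hj => by
        have := h2 j (Finset.mem_Icc.1 hj)
        rw [Fin.lt_def]; omega
  · rw [Fin.card_Icc]; omega
  · have hn : 0 < n := lt_of_le_of_lt (Nat.zero_le _) b.2
    have h0 : (⟨0, hn⟩ : Fin n) ∈ Finset.Icc a b := by rw [he]; simp
    have h1 : (⟨n - 1, by omega⟩ : Fin n) ∈ Finset.Icc a b := by rw [he]; simp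
    simp only [Finset.mem_Icc, Fin.le_def] at h0 h1
    have := b.2
    exact hu (by omega) (by omega)

theorem exists_simple_aux (π : PermAny) : ∀ m : ℕ, ∀ σ : PermAny, σ.1 = m → 2 ≤ m → IsInfl σ π →
    ∃ τ : PermAny, 2 ≤ τ.1 ∧ IsSimplePerm τ.2 ∧ IsInfl τ π := by
  intro m
  induction m using Nat.strong_induction_on with
  | _ m ih =>
  intro σ hσ hm hI
  by_cases hs : IsSimplePerm σ.2
  · exact ⟨σ, by omega, hs, hI⟩
  obtain ⟨s, hmod, h2, hu⟩ := not_simple_mod hs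
  obtain ⟨a, ha⟩ : s.Nonempty := Finset.card_pos.1 (by omega)
  obtain ⟨p, hp1, hp2⟩ := hI
  obtain ⟨τ, e, he1, he2⟩ := exists_perm (ι := {k // k ∉ s ∨ k = a}) (fun k => k.1)
    Subtype.val_injective (fun k => σ.2 k.1) (fun k l hkl => Subtype.ext (σ.2.injective hkl))
  classical
  let r : Fin σ.1 → {k // k ∉ s ∨ k = a} := fun k => if h : k ∈ s then ⟨a, Or.inr rfl⟩
    else ⟨k, Or.inl h⟩
  have hr1 : ∀ k, k ∈ s → (r k).1 = a := fun k hk => by simp [r, hk]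
  have hr2 : ∀ k, k ∉ s → (r k).1 = k := fun k hk => by simp [r, hk]
  have hrs : Function.Surjective r := by
    rintro ⟨k, hk⟩
    refine ⟨k, Subtype.ext ?_⟩
    by_cases h : k ∈ s
    · rw [hr1 k h]
      rcases hk with hk | hk
      · exact absurd h hk
      · exact hk.symm
    · exact hr2 k h
  have hcard : τ.1 = (sᶜ ∪ {a}).card := by
    have := Fintype.card_congr e
    rw [Fintype.card_fin] at this
    rw [← this, Fintype.card_subtype]
    congr 1
    ext k; simp [or_comm]
  have hcard2 : τ.1 = σ.1 - s.card + 1 := by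
    rw [hcard, Finset.card_union_of_disjoint (by simpa using ha), Finset.card_compl]; simp
  have hslt : s.card < σ.1 := by
    have := Finset.card_lt_univ_of_notMem (s := s)
      (Classical.choose_spec (not_forall.1 (fun h => hu (Finset.eq_univ_iff_forall.2 h))))
    simpa using this
  refine ih τ.1 (by omega) τ rfl (by omega) ⟨fun u => e (r (p u)), ?_, ?_⟩
  · exact e.surjective.comp (hrs.comp hp1)
  · intro u v huv
    beta_reduce at huv ⊢
    have hr : r (p u) ≠ r (p v) := fun h => huv (by rw [h])
    have hpuv : p u ≠ p v := fun h => hr (by rw [h])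
    have hr' : (r (p u)).1 ≠ (r (p v)).1 := fun h => hr (Subtype.ext h)
    rw [(hp2 u v hpuv).1, (hp2 u v hpuv).2, he1, he2]
    by_cases h1 : p u ∈ s <;> by_cases h2 : p v ∈ s
    · exact absurd (by rw [hr1 _ h1, hr1 _ h2]) hr'
    · rw [hr1 _ h1, hr2 _ h2]
      have := hmod _ h2
      have h3 := this.1
      have h4 := this.2
      constructor
      · rcases h3 with h3 | h3
        · simp [h3 _ h1, h3 _ ha]
        · exact iff_of_false (h3 _ h1).not_gt (h3 _ ha).not_gt
      · rcases h4 with h3 | h3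
        · simp [h3 _ h1, h3 _ ha]
        · exact iff_of_false (h3 _ h1).not_gt (h3 _ ha).not_gt
    · rw [hr2 _ h1, hr1 _ h2]
      have := hmod _ h1
      have h3 := this.1
      have h4 := this.2
      constructor
      · rcases h3 with h3 | h3
        · exact iff_of_false (h3 _ h2).not_gt (h3 _ ha).not_gt
        · simp [h3 _ h2, h3 _ ha]
      · rcases h4 with h3 | h3
        · exact iff_of_false (h3 _ h2).not_gt (h3 _ ha).not_gt
        · simp [h3 _ h2, h3 _ ha]
    · rw [hr2 _ h1, hr2 _ h2]; simp

theorem exists_simple (π : PermAny) (h : 2 ≤ π.1) :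
    ∃ τ : PermAny, 2 ≤ τ.1 ∧ IsSimplePerm τ.2 ∧ IsInfl τ π :=
  exists_simple_aux π π.1 π rfl h ⟨id, Function.surjective_id, fun _ _ _ => ⟨Iff.rfl, Iff.rfl⟩⟩

/-- Normalisation of the first component when `σ` has length two. -/
def Good (σ : PermAny) (α : Fin σ.1 → PermAny) : Prop :=
  σ.1 = 2 → ∀ k : Fin σ.1, k.val = 0 → ¬ IsInfl σ (α k)

theorem fin_two_eq {n : ℕ} (hn : n = 2) {a b c : Fin n} (h1 : a ≠ b) (h2 : c ≠ b) : a = c := by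
  have := a.2; have := b.2; have := c.2
  rw [Ne, Fin.ext_iff] at h1 h2
  ext; omega

theorem exists_good_aux (π σ : PermAny) : ∀ N : ℕ, ∀ p, Blk π σ p →
    (Finset.univ.filter fun a => (p a).val = 0).card = N →
    ∃ α : Fin σ.1 → PermAny, (∀ k, 0 < (α k).1) ∧ Good σ α ∧ π = infl σ α := by
  intro N
  induction N using Nat.strong_induction_on with
  | _ N ih =>
  intro p hp hN
  obtain ⟨α, e, h0, hI, hpe⟩ := hp.exists_infl
  by_cases hg : Good σ α
  · exact ⟨α, h0, hg, hI.unique⟩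
  unfold Good at hg
  push Not at hg
  obtain ⟨h2, k, hk, r, hr1, hr2⟩ := hg
  classical
  let g : (Σ l, Fin (α l).1) → Fin σ.1 := fun a =>
    if h : a.1 = k then r (Fin.cast (by rw [h]) a.2) else a.1
  have hg1 : ∀ i, g ⟨k, i⟩ = r i := fun i => by simp [g]
  have hg2 : ∀ l i, l ≠ k → g ⟨l, i⟩ = l := fun l i h => by simp [g, h]
  have hB : Blk π σ (fun a => g (e.symm a)) := by
    constructor
    · intro m
      obtain ⟨i, hi⟩ := hr1 m
      exact ⟨e ⟨k, i⟩, by simp [hg1, hi]⟩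
    · intro a b
      obtain ⟨⟨l, i⟩, rfl⟩ := e.surjective a
      obtain ⟨⟨m, j⟩, rfl⟩ := e.surjective b
      simp only [Equiv.symm_apply_apply]
      rw [hI.pos, hI.val]
      by_cases hl : l = k <;> by_cases hm : m = k
      · subst hl; subst hm
        rw [hg1, hg1]
        intro hne
        simpa using hr2 i j hne
      · subst hl
        rw [hg1, hg2 _ _ hm]
        intro hne
        rw [fin_two_eq h2 hne (Ne.symm hm)]
        simp [Ne.symm hm]
      · subst hm
        rw [hg1, hg2 _ _ hl]
        intro hne
        rw [fin_two_eq h2 hne.symm (Ne.symm hl)]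
        simp [hl]
      · rw [hg2 _ _ hl, hg2 _ _ hm]
        intro hne
        simp [hne]
  refine ih _ ?_ _ hB rfl
  rw [← hN]
  apply Finset.card_lt_card
  rw [Finset.ssubset_iff_of_subset]
  · obtain ⟨i, hi⟩ := hr1 ⟨1, by omega⟩
    refine ⟨e ⟨k, i⟩, ?_, ?_⟩
    · simp [hpe, hk]
    · simp [hg1, hi]
  · intro a
    obtain ⟨⟨l, i⟩, rfl⟩ := e.surjective a
    simp only [Finset.mem_filter, Finset.mem_univ, true_and, Equiv.symm_apply_apply, hpe]
    by_cases hl : l = k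
    · subst hl; simp [hk]
    · rw [hg2 _ _ hl]; exact id

theorem exists_good {π σ : PermAny} (h : IsInfl σ π) :
    ∃ α : Fin σ.1 → PermAny, (∀ k, 0 < (α k).1) ∧ Good σ α ∧ π = infl σ α := by
  obtain ⟨p, hp⟩ := h
  exact exists_good_aux π σ _ p hp rfl

theorem sub_single {π σ τ : PermAny} {p q} (hσ : IsSimplePerm σ.2) (h3 : 3 ≤ σ.1) (h2 : 2 ≤ τ.1)
    (hp : Blk π σ p) (hq : Blk π τ q) {a b} (hab : q a = q b) : p a = p b := by
  classical
  set s : Finset (Fin σ.1) := (Finset.univ.filter fun x => q x = q a).image p with hs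
  have mem : ∀ k, k ∈ s ↔ ∃ x, q x = q a ∧ p x = k := fun k => by simp [hs]
  have hmod : IsMod σ.2 s := by
    intro k hk
    obtain ⟨x, rfl⟩ := hp.1 k
    have hx : q x ≠ q a := fun h => hk ((mem _).2 ⟨x, h, rfl⟩)
    have hne : ∀ y, q y = q a → p y ≠ p x := fun y hy h => hk ((mem _).2 ⟨y, hy, h⟩)
    constructor
    · rcases lt_or_gt_of_ne hx with h | h
      · right
        intro j hj
        obtain ⟨y, hy, rfl⟩ := (mem _).1 hj
        rw [← (hp.2 x y (hne y hy).symm).1, (hq.2 x y (by rwa [hy])).1, hy]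
        exact h
      · left
        intro j hj
        obtain ⟨y, hy, rfl⟩ := (mem _).1 hj
        rw [← (hp.2 y x (hne y hy)).1, (hq.2 y x (by rw [hy]; exact hx.symm)).1, hy]
        exact h
    · rcases lt_or_gt_of_ne (fun h => hx (τ.2.injective h)) with h | h
      · right
        intro j hj
        obtain ⟨y, hy, rfl⟩ := (mem _).1 hj
        rw [← (hp.2 x y (hne y hy).symm).2, (hq.2 x y (by rwa [hy])).2, hy]
        exact h
      · left
        intro j hj
        obtain ⟨y, hy, rfl⟩ := (mem _).1 hj
        rw [← (hp.2 y x (hne y hy)).2, (hq.2 y x (by rw [hy]; exact hx.symm)).2, hy]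
        exact h
  have ha : p a ∈ s := (mem _).2 ⟨a, rfl, rfl⟩
  have hb : p b ∈ s := (mem _).2 ⟨b, hab.symm, rfl⟩
  rcases simple_mod hσ ⟨_, ha⟩ hmod with h | h
  · obtain ⟨c, hc⟩ := Finset.card_eq_one.1 h
    rw [hc, Finset.mem_singleton] at ha hb
    rw [ha, hb]
  exfalso
  obtain ⟨x, hx⟩ : ∃ x, q x ≠ q a := by
    have : Nontrivial (Fin τ.1) := Fin.nontrivial_iff_two_le.2 h2
    obtain ⟨l, hl⟩ := exists_ne (q a)
    obtain ⟨x, rfl⟩ := hq.1 l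
    exact ⟨x, hl⟩
  have hk : ∀ k, ∃ y, q y = q a ∧ p y = k := fun k => (mem k).1 (by rw [h]; simp)
  have hmod2 : IsMod σ.2 (Finset.univ.erase (p x)) := by
    intro k hkk
    obtain rfl : k = p x := by simpa using hkk
    constructor
    · rcases lt_or_gt_of_ne hx with h | h
      · right
        intro j hj
        obtain ⟨y, hy, rfl⟩ := hk j
        rw [← (hp.2 x y (Finset.ne_of_mem_erase hj).symm).1, (hq.2 x y (by rwa [hy])).1, hy]
        exact h
      · left
        intro j hj
        obtain ⟨y, hy, rfl⟩ := hk j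
        rw [← (hp.2 y x (Finset.ne_of_mem_erase hj)).1,
          (hq.2 y x (by rw [hy]; exact hx.symm)).1, hy]
        exact h
    · rcases lt_or_gt_of_ne (fun h => hx (τ.2.injective h)) with h | h
      · right
        intro j hj
        obtain ⟨y, hy, rfl⟩ := hk j
        rw [← (hp.2 x y (Finset.ne_of_mem_erase hj).symm).2, (hq.2 x y (by rwa [hy])).2, hy]
        exact h
      · left
        intro j hj
        obtain ⟨y, hy, rfl⟩ := hk j
        rw [← (hp.2 y x (Finset.ne_of_mem_erase hj)).2,
          (hq.2 y x (by rw [hy]; exact hx.symm)).2, hy]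
        exact h
  have hc : (Finset.univ.erase (p x)).card = σ.1 - 1 := by simp
  rcases simple_mod hσ (Finset.card_pos.1 (by omega)) hmod2 with h | h
  · omega
  · have := Finset.mem_univ (p x)
    rw [← h] at this
    simp at this

theorem blk_eq {π σ τ : PermAny} {p q} (hp : Blk π σ p) (hq : Blk π τ q)
    (h1 : ∀ a b, q a = q b → p a = p b) (h2 : ∀ a b, p a = p b → q a = q b) :
    σ = τ ∧ ∀ a, (p a : ℕ) = q a := by
  let s := Function.surjInv hp.1
  have hs : ∀ k, p (s k) = k := Function.surjInv_eq hp.1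
  have hbij : Function.Bijective (fun k => q (s k)) := by
    constructor
    · intro k l hkl
      have := h1 _ _ hkl
      rwa [hs, hs] at this
    · intro l
      obtain ⟨a, rfl⟩ := hq.1 l
      exact ⟨p a, h2 _ _ (hs _)⟩
  let e := Equiv.ofBijective _ hbij
  have he : ∀ a, e (p a) = q a := fun a => h2 _ _ (hs _)
  have e1 : ∀ k l, e k < e l ↔ k < l := by
    intro k l
    obtain ⟨a, rfl⟩ := hp.1 k
    obtain ⟨b, rfl⟩ := hp.1 l
    rw [he, he]
    by_cases h : p a = p b
    · simp [h, h2 _ _ h]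
    · rw [← (hp.2 a b h).1, (hq.2 a b (fun hh => h (h1 _ _ hh))).1]
  have hst : σ = τ := by
    refine perm_ext e e1 ?_
    intro k l
    obtain ⟨a, rfl⟩ := hp.1 k
    obtain ⟨b, rfl⟩ := hp.1 l
    rw [he, he]
    by_cases h : p a = p b
    · simp [h, h2 _ _ h]
    · rw [← (hp.2 a b h).2, (hq.2 a b (fun hh => h (h1 _ _ hh))).2]
  refine ⟨hst, ?_⟩
  subst hst
  intro a
  rw [← he, equiv_fin_eq_refl e e1]; rfl

theorem cle_antisymm {p q : PermAny} (h1 : cle p q) (h2 : cle q p) : p = q := by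
  obtain ⟨f, hf, hf'⟩ := h1
  obtain ⟨g, hg, -⟩ := h2
  have hb : Function.Bijective f := by
    rw [Fintype.bijective_iff_injective_and_card]
    refine ⟨hf.injective, le_antisymm (Fintype.card_le_of_injective f hf.injective)
      (Fintype.card_le_of_injective g hg.injective)⟩
  exact perm_ext (Equiv.ofBijective f hb) (fun a b => hf.lt_iff_lt) (fun a b => (hf' a b).symm)

theorem Blk.first {π σ : PermAny} {p} (hp : Blk π σ p) (h : 0 < π.1) : (p ⟨0, h⟩).val = 0 := by
  by_contra hne
  obtain ⟨u, hu⟩ := hp.1 ⟨0, (p ⟨0, h⟩).pos⟩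
  have h1 : p u ≠ p ⟨0, h⟩ := by
    rw [hu]; intro h; apply hne; rw [← h]
  have := (hp.2 u _ h1).1
  rw [hu, Fin.lt_def, Fin.lt_def] at this
  simp at this; omega

theorem Blk.last {π σ : PermAny} {p} (hp : Blk π σ p) (h : 0 < π.1) :
    (p ⟨π.1 - 1, by omega⟩).val = σ.1 - 1 := by
  by_contra hne
  have hpos := (p ⟨0, h⟩).pos
  obtain ⟨u, hu⟩ := hp.1 ⟨σ.1 - 1, by omega⟩
  have h1 : p ⟨π.1 - 1, by omega⟩ ≠ p u := by
    rw [hu]; intro h; apply hne; rw [h]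
  have := (hp.2 _ u h1).1
  rw [hu, Fin.lt_def, Fin.lt_def] at this
  simp only at this
  omega

theorem two_eq {π σ τ : PermAny} {p q} (hσ : σ.1 = 2) (hτ : τ.1 = 2) (h0 : 0 < π.1)
    (hp : Blk π σ p) (hq : Blk π τ q) : σ = τ := by
  have p1 := hp.first h0
  have p2 := hp.last h0
  have q1 := hq.first h0
  have q2 := hq.last h0
  have e1 := (hp.2 ⟨0, h0⟩ ⟨π.1 - 1, by omega⟩ (by rw [Ne, Fin.ext_iff]; omega)).2
  have e2 := (hq.2 ⟨0, h0⟩ ⟨π.1 - 1, by omega⟩ (by rw [Ne, Fin.ext_iff]; omega)).2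
  have e3 := e1.symm.trans e2
  obtain ⟨n, σ⟩ := σ
  obtain ⟨m, τ⟩ := τ
  dsimp only at hσ hτ
  subst hσ; subst hτ
  have a1 : p ⟨0, h0⟩ = 0 := Fin.ext p1
  have a2 : p ⟨π.1 - 1, by omega⟩ = 1 := Fin.ext p2
  have a3 : q ⟨0, h0⟩ = 0 := Fin.ext q1
  have a4 : q ⟨π.1 - 1, by omega⟩ = 1 := Fin.ext q2
  rw [a1, a2, a3, a4] at e3
  congr 1
  revert e3
  clear * -
  revert σ τ
  decide

theorem good_const {π σ : PermAny} {p} {β : Fin σ.1 → PermAny}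
    {e : (Σ k, Fin (β k).1) ≃ Fin π.1} (hσ : σ.1 = 2) (hI : InflEq π σ β e) (hg : Good σ β)
    (hp : Blk π σ p) {a b} (ha : ((e.symm a).1).val = 0) (hb : ((e.symm b).1).val = 0) :
    p a = p b := by
  by_contra hne
  obtain ⟨⟨k, i⟩, rfl⟩ := e.surjective a
  obtain ⟨⟨l, j⟩, rfl⟩ := e.surjective b
  simp only [Equiv.symm_apply_apply] at ha hb
  obtain rfl : k = l := Fin.ext (by omega)
  refine hg hσ k ha ⟨fun i => p (e ⟨k, i⟩), ?_, ?_⟩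
  · intro m
    by_cases h : p (e ⟨k, i⟩) = m
    · exact ⟨i, h⟩
    · exact ⟨j, fin_two_eq hσ (Ne.symm hne) (Ne.symm h)⟩
  · intro u v huv
    have := hp.2 _ _ huv
    rw [hI.pos, hI.val] at this
    simpa using this

theorem infl_unique {σ τ : PermAny} {α : Fin σ.1 → PermAny} {β : Fin τ.1 → PermAny}
    (hσ : IsSimplePerm σ.2) (hτ : IsSimplePerm τ.2) (hσ2 : 2 ≤ σ.1) (hτ2 : 2 ≤ τ.1)
    (hα : ∀ k, 0 < (α k).1) (hβ : ∀ k, 0 < (β k).1) (gα : Good σ α) (gβ : Good τ β)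
    (h : infl σ α = infl τ β) :
    (⟨σ, α⟩ : Σ σ : PermAny, Fin σ.1 → PermAny) = ⟨τ, β⟩ := by
  obtain ⟨π, hπ⟩ : ∃ π, π = infl σ α := ⟨_, rfl⟩
  obtain ⟨e, he⟩ : ∃ e, InflEq π σ α e := by subst hπ; exact ⟨_, infl_spec σ α⟩
  obtain ⟨e', he'⟩ : ∃ e, InflEq π τ β e := by subst hπ; rw [h]; exact ⟨_, infl_spec τ β⟩
  clear h hπ
  have hp := he.blk hα
  have hq := he'.blk hβ
  have hle : ∀ {σ τ : PermAny} {p q}, Blk π σ p → Blk π τ q → (∀ a b, q a = q b → p a = p b) →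
      σ.1 ≤ τ.1 := by
    intro σ τ p q hp hq hh
    have hs : ∀ k, q (Function.surjInv hq.1 k) = k := Function.surjInv_eq hq.1
    have : Function.Surjective (fun k => p (Function.surjInv hq.1 k)) := by
      intro k
      obtain ⟨a, rfl⟩ := hp.1 k
      exact ⟨q a, hh _ _ (hs _)⟩
    simpa using Fintype.card_le_of_surjective _ this
  have hpos : 0 < π.1 := (e ⟨⟨0, by omega⟩, ⟨0, hα _⟩⟩).pos
  have key : σ = τ ∧ ∀ a, ((e.symm a).1 : ℕ) = (e'.symm a).1 := by
    by_cases h3 : 3 ≤ σ.1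
    · have k1 := fun a b => sub_single (a := a) (b := b) hσ h3 hτ2 hp hq
      by_cases h4 : 3 ≤ τ.1
      · have k2 := fun a b => sub_single (a := a) (b := b) hτ h4 hσ2 hq hp
        exact blk_eq hp hq k1 k2
      · have := hle hp hq k1
        omega
    · by_cases h4 : 3 ≤ τ.1
      · have k2 := fun a b => sub_single (a := a) (b := b) hτ h4 hσ2 hq hp
        have := hle hq hp k2
        omega
      · have hσ' : σ.1 = 2 := by omega
        obtain rfl := two_eq hσ' (by omega) hpos hp hq
        have hz := hp.first hpos
        have hz' := hq.first hpos
        have c1 := fun a b => good_const (a := a) (b := b) hσ' he' gβ hp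
        have c2 := fun a b => good_const (a := a) (b := b) hσ' he gα hq
        have i1 : ∀ a, ((e.symm a).1).val = 0 → ((e'.symm a).1).val = 0 := by
          intro a ha
          have := c2 a _ ha hz
          rw [this]; exact hz'
        have i2 : ∀ a, ((e'.symm a).1).val = 0 → ((e.symm a).1).val = 0 := by
          intro a ha
          have := c1 a _ ha hz'
          rw [this]; exact hz
        refine ⟨rfl, fun a => ?_⟩
        have := i1 a
        have := i2 a
        have := ((e.symm a).1).2
        have := ((e'.symm a).1).2
        omega
  obtain ⟨rfl, hk⟩ := key
  congr 1
  have main : ∀ {α β : Fin σ.1 → PermAny} {e e'}, InflEq π σ α e → InflEq π σ β e' →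
      (∀ a, ((e.symm a).1 : ℕ) = (e'.symm a).1) → ∀ k, cle (α k) (β k) := by
    intro α β e e' he he' hk k
    have : ∀ i : Fin (α k).1, ∃ j : Fin (β k).1, e' ⟨k, j⟩ = e ⟨k, i⟩ := by
      intro i
      obtain ⟨⟨l, j⟩, hj⟩ := e'.surjective (e ⟨k, i⟩)
      have h := hk (e ⟨k, i⟩)
      rw [← hj, Equiv.symm_apply_apply, hj, Equiv.symm_apply_apply] at h
      obtain rfl : k = l := Fin.ext h
      exact ⟨j, hj⟩
    choose f hf using this
    refine ⟨f, fun i j hij => ?_, fun i j => ?_⟩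
    · have h1 := he.pos ⟨k, i⟩ ⟨k, j⟩
      rw [← hf, ← hf, he'.pos] at h1
      simpa [hij] using h1
    · have h1 := he.val ⟨k, i⟩ ⟨k, j⟩
      rw [← hf, ← hf, he'.val] at h1
      simpa using h1.symm
  funext k
  exact cle_antisymm (main he he' hk k) (main he' he (fun a => (hk a).symm) k)

end AA

namespace AA

theorem cle_of_zero {p q : PermAny} (h : p.1 = 0) : cle p q := by
  obtain ⟨n, p⟩ := p
  dsimp only at h
  subst h
  exact ⟨fun a => a.elim0, fun a => a.elim0, fun a => a.elim0⟩

theorem cle_of_one {p q : PermAny} (h : p.1 = 1) (h' : 0 < q.1) : cle p q := by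
  obtain ⟨n, p⟩ := p
  dsimp only at h
  subst h
  refine ⟨fun a => ⟨0, h'⟩, fun a b hab => ?_, fun a b => ?_⟩
  · exact absurd hab (by rw [Subsingleton.elim a b]; exact lt_irrefl _)
  · rw [Subsingleton.elim a b]; simp

theorem comp_lt {σ : PermAny} {α : Fin σ.1 → PermAny} (h2 : 2 ≤ σ.1) (h0 : ∀ k, 0 < (α k).1)
    (k : Fin σ.1) : (α k).1 < (infl σ α).1 := by
  rw [infl_size]
  have : Nontrivial (Fin σ.1) := Fin.nontrivial_iff_two_le.2 h2
  obtain ⟨l, hl⟩ := exists_ne k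
  exact Finset.single_lt_sum (f := fun k => (α k).1) hl (Finset.mem_univ _) (Finset.mem_univ _)
    (h0 l) (fun _ _ _ => Nat.zero_le _)

theorem exists_decomp (π : PermAny) (h : 2 ≤ π.1) :
    ∃ (σ : PermAny) (α : Fin σ.1 → PermAny), 2 ≤ σ.1 ∧ IsSimplePerm σ.2 ∧ (∀ k, 0 < (α k).1) ∧
      Good σ α ∧ π = infl σ α := by
  obtain ⟨σ, h2, hs, hI⟩ := exists_simple π h
  obtain ⟨α, h0, hg, he⟩ := exists_good hI
  exact ⟨σ, α, h2, hs, h0, hg, he⟩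

theorem wqo (C : Set PermAny) (hC : IsPermClass C)
    (hfin : {p : PermAny | p ∈ C ∧ IsSimplePerm p.2}.Finite) :
    C.PartiallyWellOrderedOn cle := by
  rw [Set.PartiallyWellOrderedOn.iff_not_exists_isMinBadSeq (fun p : PermAny => p.1)]
  rintro ⟨f, ⟨hfC, hbad⟩, hmin⟩
  have hn0 : ∀ n, 0 < (f n).1 := by
    intro n
    by_contra h
    exact hbad n (n+1) (Nat.lt_succ_self n) (cle_of_zero (by omega))
  have hn1 : ∀ n, 2 ≤ (f n).1 := by
    intro n
    by_contra h
    have := hn0 n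
    exact hbad n (n+1) (Nat.lt_succ_self n) (cle_of_one (by omega) (hn0 _))
  choose σ α h2 hs h0 hg he using fun n => exists_decomp (f n) (hn1 n)
  have hσC : ∀ n, σ n ∈ {p : PermAny | p ∈ C ∧ IsSimplePerm p.2} := fun n =>
    ⟨hC _ (hfC n) _ (by rw [he n]; exact cle_infl' _ _ (h0 n)), hs n⟩
  obtain ⟨σ0, hinf⟩ : ∃ σ0, ∃ᶠ n in Filter.atTop, σ n = σ0 := by
    by_contra hcon
    push Not at hcon
    have : ∀ σ0 ∈ {p : PermAny | p ∈ C ∧ IsSimplePerm p.2}, ∀ᶠ n in Filter.atTop, σ n ≠ σ0 :=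
      fun σ0 _ => by simpa using hcon σ0
    rw [← Set.Finite.eventually_all hfin] at this
    obtain ⟨n, hn⟩ := this.exists
    exact hn _ (hσC n) rfl
  obtain ⟨φ, hφ, hφσ⟩ := Filter.extraction_of_frequently_atTop hinf
  let S : Set PermAny := {x | ∃ n, cle x (f n) ∧ x.1 < (f n).1}
  have hS : S.PartiallyWellOrderedOn cle := by
    rw [Set.PartiallyWellOrderedOn.iff_forall_not_isBadSeq]
    rintro g ⟨hgS, hgbad⟩
    choose N hN1 hN2 using hgS
    obtain ⟨i0, hi0⟩ : ∃ i0, ∀ i, N i0 ≤ N i := by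
      obtain ⟨i0, hi0⟩ := exists_minimal_of_wellFoundedLT (P := fun n => ∃ i, N i = n) ⟨_, 0, rfl⟩
      obtain ⟨i, rfl⟩ := hi0.1
      refine ⟨i, fun j => ?_⟩
      by_contra hlt
      exact hlt (hi0.2 ⟨j, rfl⟩ (by omega))
    refine hmin (N i0) (fun m => if m < N i0 then f m else g (i0 + (m - N i0))) ?_ ?_ ⟨?_, ?_⟩
    · intro m hm; simp [hm]
    · simpa using hN2 i0
    · intro m
      dsimp only
      split_ifs
      · exact hfC m
      · exact hC _ (hfC _) _ (hN1 _)
    · intro m n hmn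
      dsimp only
      split_ifs with h1 h2 h2
      · exact hbad m n hmn
      · intro hle
        exact hbad m (N (i0 + (n - N i0))) (lt_of_lt_of_le h1 (hi0 _)) (cle_trans hle (hN1 _))
      · omega
      · exact hgbad _ _ (by omega)
  have ht : ∀ n, ∃ t : Fin σ0.1 → PermAny, (∀ k, t k ∈ S) ∧ f (φ n) = infl σ0 t := by
    intro n
    have h := he (φ n)
    have h2' := h2 (φ n)
    have h0' := h0 (φ n)
    have hmem : ∀ k, (α (φ n) k) ∈ S := fun k =>
      ⟨φ n, by rw [h]; exact cle_infl _ _ k, by rw [h]; exact comp_lt h2' h0' k⟩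
    have hσ := hφσ n
    generalize α (φ n) = a at *
    generalize σ (φ n) = s at *
    subst hσ
    exact ⟨a, hmem, h⟩
  choose t htS ht using ht
  have : IsPreorder S (fun a b => cle a.1 b.1) :=
    { refl := fun a => cle_refl _, trans := fun a b c => cle_trans }
  have hw : WellQuasiOrdered (fun a b : S => cle a.1 b.1) := by
    intro u
    exact hS u
  obtain ⟨m, n, hmn, hr⟩ := (WellQuasiOrdered.pi (ι := Fin σ0.1) (fun _ => hw))
    (fun n k => ⟨t n k, htS n k⟩)
  refine hbad (φ m) (φ n) (hφ hmn) ?_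
  rw [ht, ht]
  exact infl_mono _ hr

/-- Nonempty members of the class. -/
abbrev NC (C : Set PermAny) : Type := {p : PermAny // p ∈ C ∧ 0 < p.1}

instance (C : Set PermAny) : Preorder (NC C) where
  le a b := cle a.1 b.1
  le_refl a := cle_refl _
  le_trans a b c := cle_trans

theorem nc_wqo (C : Set PermAny) (hC : IsPermClass C)
    (hfin : {p : PermAny | p ∈ C ∧ IsSimplePerm p.2}.Finite) : WellQuasiOrderedLE (NC C) :=
  ⟨fun f => wqo C hC hfin (fun n => ⟨(f n).1, (f n).2.1⟩)⟩

theorem lowerSet_wf {N : Type*} [Preorder N] [WellQuasiOrderedLE N] :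
    WellFoundedLT (LowerSet N) := by
  rw [WellFoundedLT, isWellFounded_iff, RelEmbedding.wellFounded_iff_isEmpty]
  refine ⟨fun D => ?_⟩
  have hlt : ∀ i j, i < j → D j < D i := fun i j h => D.map_rel_iff.2 h
  have : ∀ i, ∃ x, x ∈ D i ∧ x ∉ D (i+1) := by
    intro i
    have := hlt i (i+1) (Nat.lt_succ_self i)
    by_contra hc
    push Not at hc
    exact this.not_ge hc
  choose x hx hx' using this
  obtain ⟨i, j, hij, hle⟩ := wellQuasiOrdered_le x
  have h1 : D j ≤ D (i+1) := by
    rcases (Nat.succ_le_of_lt hij).eq_or_lt with h | h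
    · rw [← h]
    · exact (hlt _ _ h).le
  exact hx' i ((D (i+1)).lower hle (h1 (hx j)))

/-- A product of lower sets. -/
def box {N : Type*} [Preorder N] {m : ℕ} (D : Fin m → LowerSet N) : Set (Fin m → N) :=
  {z | ∀ k, z k ∈ D k}

theorem finite_boxes {N : Type*} [Preorder N] [WellQuasiOrderedLE N] {m : ℕ}
    (A : LowerSet (Fin m → N)) :
    ∃ L : List (Fin m → LowerSet N), ∀ z, z ∈ A ↔ ∃ D ∈ L, z ∈ box D := by
  have := lowerSet_wf (N := Fin m → N)
  induction A using this.wf.induction with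
  | _ A ih =>
  by_cases hdir : ∀ x ∈ A, ∀ y ∈ A, ∃ z ∈ A, x ≤ z ∧ y ≤ z
  · by_cases hne : ∃ x, x ∈ A
    swap
    · push Not at hne
      exact ⟨[], fun z => by simp [hne z]⟩
    obtain ⟨x0, hx0⟩ := hne
    refine ⟨[fun k => ⟨{x | ∃ z ∈ A, x ≤ z k}, fun a b hab ⟨z, hz, h⟩ => ⟨z, hz, hab.trans h⟩⟩],
      fun z => ?_⟩
    simp only [List.mem_singleton, exists_eq_left]
    constructor
    · exact fun hz k => ⟨z, hz, le_rfl⟩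
    · intro hz
      choose w hw hzw using hz
      have : ∀ s : Finset (Fin m), ∃ v ∈ A, ∀ k ∈ s, w k ≤ v := by
        intro s
        induction s using Finset.induction_on with
        | empty => exact ⟨x0, hx0, by simp⟩
        | insert a s _ ih =>
          obtain ⟨v, hv, hv'⟩ := ih
          obtain ⟨u, hu, h1, h2⟩ := hdir v hv (w a) (hw a)
          refine ⟨u, hu, fun k hk => ?_⟩
          rcases Finset.mem_insert.1 hk with rfl | hk
          · exact h2
          · exact (hv' k hk).trans h1
      obtain ⟨v, hv, hv'⟩ := this Finset.univ
      exact A.lower (fun k => (hzw k).trans (hv' k (Finset.mem_univ _) k)) hv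
  · push Not at hdir
    obtain ⟨x, hx, y, hy, hxy⟩ := hdir
    let F : (Fin m → N) → LowerSet (Fin m → N) := fun x =>
      ⟨{z | z ∈ A ∧ ¬ x ≤ z}, fun a b hab ⟨h1, h2⟩ => ⟨A.lower hab h1, fun h => h2 (h.trans hab)⟩⟩
    have hF : ∀ x ∈ A, F x < A := by
      intro x hx
      refine lt_of_le_not_ge (fun z hz => hz.1) (fun h => (h hx).2 le_rfl)
    obtain ⟨L1, h1⟩ := ih _ (hF x hx)
    obtain ⟨L2, h2⟩ := ih _ (hF y hy)
    refine ⟨L1 ++ L2, fun z => ?_⟩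
    have hz : z ∈ A ↔ z ∈ F x ∨ z ∈ F y := by
      constructor
      · intro hz
        by_cases h : x ≤ z
        · exact Or.inr ⟨hz, hxy z hz h⟩
        · exact Or.inl ⟨hz, h⟩
      · rintro (h | h) <;> exact h.1
    rw [hz, h1, h2]
    simp only [List.mem_append, or_and_right, exists_or]

end AA

namespace AA
open PowerSeries

/-- Generating function of a set with a size function. -/
noncomputable def gf {T : Type*} (sz : T → ℕ) (S : Set T) : PowerSeries ℚ :=
  PowerSeries.mk fun n => ({s | s ∈ S ∧ sz s = n}.ncard : ℚ)

section
variable {T : Type*} {sz : T → ℕ}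

theorem gf_empty : gf sz (∅ : Set T) = 0 := by
  ext n; simp [gf]

theorem gf_union_inter (hF : ∀ n, {s | sz s = n}.Finite) (A B : Set T) :
    gf sz (A ∪ B) + gf sz (A ∩ B) = gf sz A + gf sz B := by
  ext n
  simp only [gf, map_add, coeff_mk]
  have h := Set.ncard_union_add_ncard_inter {s | s ∈ A ∧ sz s = n} {s | s ∈ B ∧ sz s = n}
    ((hF n).subset fun s hs => hs.2) ((hF n).subset fun s hs => hs.2)
  have h1 : {s | s ∈ A ∪ B ∧ sz s = n} = {s | s ∈ A ∧ sz s = n} ∪ {s | s ∈ B ∧ sz s = n} := by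
    ext s; simp [or_and_right]
  have h2 : {s | s ∈ A ∩ B ∧ sz s = n} = {s | s ∈ A ∧ sz s = n} ∩ {s | s ∈ B ∧ sz s = n} := by
    ext s; simp
  rw [h1, h2]
  exact_mod_cast h

theorem gf_union (hF : ∀ n, {s | sz s = n}.Finite) {A B : Set T} (h : Disjoint A B) :
    gf sz (A ∪ B) = gf sz A + gf sz B := by
  have := gf_union_inter hF A B
  rwa [h.inter_eq, gf_empty, add_zero] at this

theorem gf_biUnion (hF : ∀ n, {s | sz s = n}.Finite) {I : Type*} (s : Finset I)
    (A : I → Set T) (h : ∀ i ∈ s, ∀ j ∈ s, i ≠ j → Disjoint (A i) (A j)) :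
    gf sz {x | ∃ i ∈ s, x ∈ A i} = ∑ i ∈ s, gf sz (A i) := by
  classical
  induction s using Finset.induction_on with
  | empty => simp [gf_empty]
  | insert a s ha ih =>
    rw [Finset.sum_insert ha, ← ih, ← gf_union hF]
    · congr 1
      ext x; simp
    · rw [Set.disjoint_left]
      rintro x hx ⟨i, hi, hxi⟩
      exact Set.disjoint_left.1 (h a (Finset.mem_insert_self _ _) i (Finset.mem_insert_of_mem hi)
        (by rintro rfl; exact ha hi)) hx hxi
    · intro i hi j hj
      exact h i (Finset.mem_insert_of_mem hi) j (Finset.mem_insert_of_mem hj)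

theorem gf_image {U : Type*} {sz' : U → ℕ} (φ : T → U) {S : Set T} (hinj : Set.InjOn φ S)
    (hsz : ∀ s ∈ S, sz' (φ s) = sz s) : gf sz' (φ '' S) = gf sz S := by
  ext n
  simp only [gf, coeff_mk]
  have : {u | u ∈ φ '' S ∧ sz' u = n} = φ '' {s | s ∈ S ∧ sz s = n} := by
    ext u
    constructor
    · rintro ⟨⟨s, hs, rfl⟩, h⟩
      exact ⟨s, ⟨hs, by rw [← hsz s hs]; exact h⟩, rfl⟩
    · rintro ⟨s, ⟨hs, h⟩, rfl⟩
      exact ⟨⟨s, hs, rfl⟩, by rw [hsz s hs]; exact h⟩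
  rw [this, Set.ncard_image_of_injOn (hinj.mono fun s hs => hs.1)]

theorem gf_const {S : Set T} (h : ∀ s ∈ S, 0 < sz s) : constantCoeff (gf sz S) = 0 := by
  rw [← coeff_zero_eq_constantCoeff_apply, gf, coeff_mk]
  have : {s | s ∈ S ∧ sz s = 0} = ∅ := by
    ext s
    simp only [Set.mem_setOf_eq, Set.mem_empty_iff_false, iff_false]
    rintro ⟨h1, h2⟩
    have := h s h1
    omega
  rw [this]; simp

theorem gf_pi (hF : ∀ n, {s | sz s = n}.Finite) {m : ℕ} (S : Fin m → Set T) :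
    gf (fun z : Fin m → T => ∑ k, sz (z k)) {z | ∀ k, z k ∈ S k} = ∏ k, gf sz (S k) := by
  classical
  ext n
  rw [coeff_prod]
  simp only [gf, coeff_mk]
  have hf : ∀ k j, {s | s ∈ S k ∧ sz s = j}.Finite := fun k j => (hF j).subset fun s hs => hs.2
  have hset : {z : Fin m → T | z ∈ {z | ∀ k, z k ∈ S k} ∧ ∑ k, sz (z k) = n} =
      ((Finset.finsuppAntidiag Finset.univ n).biUnion
        (fun l => Fintype.piFinset (fun k => (hf k (l k)).toFinset)) : Finset (Fin m → T)) := by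
    ext z
    simp only [Set.mem_setOf_eq, Finset.coe_biUnion, Set.mem_iUnion, Finset.mem_coe,
      Fintype.mem_piFinset, Set.Finite.mem_toFinset, Finset.mem_finsuppAntidiag]
    constructor
    · rintro ⟨h1, h2⟩
      exact ⟨Finsupp.equivFunOnFinite.symm (fun k => sz (z k)), ⟨by simpa using h2, by simp⟩,
        fun k => ⟨h1 k, rfl⟩⟩
    · rintro ⟨l, ⟨h1, -⟩, h2⟩
      refine ⟨fun k => (h2 k).1, ?_⟩
      rw [← h1]
      exact Finset.sum_congr rfl fun k _ => (h2 k).2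
  rw [hset, Set.ncard_coe_finset, Finset.card_biUnion]
  · push_cast
    refine Finset.sum_congr rfl fun l _ => ?_
    rw [Fintype.card_piFinset]
    push_cast
    refine Finset.prod_congr rfl fun k _ => ?_
    rw [Set.ncard_eq_toFinset_card _ (hf k (l k))]
  · intro l _ l' _ hne
    rw [Function.onFun, Finset.disjoint_left]
    intro z hz hz'
    simp only [Fintype.mem_piFinset, Set.Finite.mem_toFinset, Set.mem_setOf_eq] at hz hz'
    exact hne (Finsupp.ext fun k => (hz k).2.symm.trans (hz' k).2)

theorem pi_finite (hF : ∀ n, {s | sz s = n}.Finite) {m : ℕ} (n : ℕ) :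
    {z : Fin m → T | ∑ k, sz (z k) = n}.Finite := by
  have h1 : {t | sz t ≤ n}.Finite := by
    have : {t | sz t ≤ n} = ⋃ j ∈ Finset.range (n+1), {t | sz t = j} := by
      ext t; simp [Nat.lt_succ_iff]
    rw [this]
    exact Set.Finite.biUnion (Finset.finite_toSet _) (fun j _ => hF j)
  refine (Set.Finite.pi' (fun _ : Fin m => h1)).subset ?_
  intro z hz k
  simp only [Set.mem_setOf_eq] at hz ⊢
  rw [← hz]
  exact Finset.single_le_sum (f := fun k => sz (z k)) (fun _ _ => Nat.zero_le _) (Finset.mem_univ k)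

theorem gf_boxes [Preorder T] (hF : ∀ n, {s | sz s = n}.Finite) {m : ℕ}
    (V : AddSubgroup (PowerSeries ℚ)) (K : Fin m → Set T) (D0 : LowerSet T)
    (hV : ∀ D : Fin m → LowerSet T, (∀ k, D k ≤ D0) →
      ∏ k, gf sz ((D k : Set T) ∩ K k) ∈ V) (L : List (Fin m → LowerSet T)) :
    ∀ E : Fin m → LowerSet T, (∀ k, E k ≤ D0) →
      gf (fun z : Fin m → T => ∑ k, sz (z k))
        {z | z ∈ box E ∧ (∃ D ∈ L, z ∈ box D) ∧ ∀ k, z k ∈ K k} ∈ V := by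
  induction L with
  | nil =>
    intro E hE
    have : {z | z ∈ box E ∧ (∃ D ∈ ([] : List (Fin m → LowerSet T)), z ∈ box D) ∧
      ∀ k, z k ∈ K k} = ∅ := by ext z; simp
    rw [this, gf_empty]
    exact V.zero_mem
  | cons D L ih =>
    intro E hE
    have hE' : ∀ k, (E ⊓ D) k ≤ D0 := fun k => inf_le_left.trans (hE k)
    have h1 := gf_union_inter (pi_finite hF)
      {z | ∀ k, z k ∈ (((E ⊓ D) k : LowerSet T) : Set T) ∩ K k}
      {z | z ∈ box E ∧ (∃ D ∈ L, z ∈ box D) ∧ ∀ k, z k ∈ K k}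
    have e1 : {z | ∀ k, z k ∈ (((E ⊓ D) k : LowerSet T) : Set T) ∩ K k} ∪
      {z | z ∈ box E ∧ (∃ D ∈ L, z ∈ box D) ∧ ∀ k, z k ∈ K k} =
      {z | z ∈ box E ∧ (∃ D' ∈ D :: L, z ∈ box D') ∧ ∀ k, z k ∈ K k} := by
      ext z
      simp [box, forall_and]
      tauto
    have e2 : {z | ∀ k, z k ∈ (((E ⊓ D) k : LowerSet T) : Set T) ∩ K k} ∩
      {z | z ∈ box E ∧ (∃ D ∈ L, z ∈ box D) ∧ ∀ k, z k ∈ K k} =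
      {z | z ∈ box (E ⊓ D) ∧ (∃ D' ∈ L, z ∈ box D') ∧ ∀ k, z k ∈ K k} := by
      ext z
      simp [box, forall_and]
      tauto
    rw [e1, e2, gf_pi hF] at h1
    rw [eq_sub_of_add_eq h1]
    exact V.sub_mem (V.add_mem (hV _ hE') (ih E hE)) (ih _ hE')

end
end AA

namespace AA
open PowerSeries

section
variable {C : Set PermAny}

/-- Size of a member. -/
def nsz (p : NC C) : ℕ := p.1.1

theorem perm_finite (n : ℕ) : {p : PermAny | p.1 = n}.Finite := by
  have : {p : PermAny | p.1 = n} = Set.range (fun e : Equiv.Perm (Fin n) => (⟨n, e⟩ : PermAny)) := by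
    ext ⟨m, e⟩
    constructor
    · rintro h
      have h' : m = n := h
      subst h'
      exact ⟨e, rfl⟩
    · rintro ⟨e', h⟩
      rw [← h]
      rfl
  rw [this]
  exact Set.finite_range _

theorem nsz_finite (n : ℕ) : {p : NC C | nsz p = n}.Finite :=
  Set.Finite.preimage (f := fun p : NC C => p.1) Subtype.val_injective.injOn (perm_finite n)

/-- Constraint sets. -/
def KK (C : Set PermAny) (σ : PermAny) : Set (NC C) := {p | ¬ IsInfl σ p.1}

/-- Constraint boxes. -/
def KB (C : Set PermAny) (σ : PermAny) (k : Fin σ.1) : Set (NC C) :=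
  {p | σ.1 = 2 → k.val = 0 → ¬ IsInfl σ p.1}

/-- Tuples inflating to members of `D`. -/
def tup (σ : PermAny) (D : LowerSet (NC C)) : Set (Fin σ.1 → NC C) :=
  {z | (∃ p ∈ D, p.1 = infl σ (fun k => (z k).1)) ∧ ∀ k, z k ∈ KB C σ k}

/-- Normal form decomposition. -/
def IsDec (σ : PermAny) (p : PermAny) : Prop :=
  ∃ α : Fin σ.1 → PermAny, (∀ k, 0 < (α k).1) ∧ Good σ α ∧ p = infl σ α

theorem gf_part (hC : IsPermClass C) {σ : PermAny} (hσ : IsSimplePerm σ.2) (h2 : 2 ≤ σ.1)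
    (D : LowerSet (NC C)) :
    gf nsz {p : NC C | p ∈ D ∧ IsDec σ p.1} =
      gf (fun z : Fin σ.1 → NC C => ∑ k, nsz (z k)) (tup σ D) := by
  rw [← gf_image (sz := nsz) (sz' := fun p : PermAny => p.1) (fun p : NC C => p.1)
    Subtype.val_injective.injOn (fun _ _ => rfl)]
  rw [← gf_image (sz' := fun p : PermAny => p.1) (S := tup σ D)
    (fun z : Fin σ.1 → NC C => infl σ (fun k => (z k).1))]
  · congr 1
    ext q
    constructor
    · rintro ⟨p, ⟨hp, α, h0, hg, he⟩, rfl⟩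
      have hmem : ∀ k, α k ∈ C := fun k => hC p.1 p.2.1 (α k) (by
        have := cle_infl σ α k
        rw [← he] at this
        exact this)
      refine ⟨fun k => ⟨α k, hmem k, h0 k⟩, ⟨⟨p, hp, he⟩, fun k h hk => hg h k hk⟩, he.symm⟩
    · rintro ⟨z, ⟨⟨p, hp, he⟩, hz⟩, rfl⟩
      exact ⟨p, ⟨hp, fun k => (z k).1, fun k => (z k).2.2, fun h k hk => hz k h hk, he⟩, he⟩
  · intro z hz w hw h
    have := infl_unique hσ hσ h2 h2 (fun k => (z k).2.2) (fun k => (w k).2.2)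
      (fun h k hk => hz.2 k h hk) (fun h k hk => hw.2 k h hk) h
    have := eq_of_heq (Sigma.mk.inj this).2
    funext k
    exact Subtype.ext (congrFun this k)
  · intro z _
    exact infl_size _ _

theorem gf_tup_mem (hC : IsPermClass C) (hwqo : WellQuasiOrderedLE (NC C)) (σ : PermAny) (h2 : 2 ≤ σ.1) (D : LowerSet (NC C))
    (V : AddSubgroup (PowerSeries ℚ))
    (hV : ∀ E : Fin σ.1 → LowerSet (NC C), (∀ k, E k ≤ D) →
      ∏ k, gf nsz ((E k : Set (NC C)) ∩ KB C σ k) ∈ V) :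
    gf (fun z : Fin σ.1 → NC C => ∑ k, nsz (z k)) (tup σ D) ∈ V := by
  let A : LowerSet (Fin σ.1 → NC C) :=
    ⟨{z | ∃ p ∈ D, cle (infl σ (fun k => (z k).1)) p.1}, by
      rintro z w hzw ⟨p, hp, h⟩
      exact ⟨p, hp, cle_trans (infl_mono σ (fun k => hzw k)) h⟩⟩
  obtain ⟨L, hL⟩ := finite_boxes A
  have hmem : ∀ z : Fin σ.1 → NC C, (∃ p ∈ D, p.1 = infl σ (fun k => (z k).1)) →
      z ∈ A := fun z ⟨p, hp, he⟩ => ⟨p, hp, he ▸ cle_refl _⟩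
  have := gf_boxes nsz_finite V (KB C σ) D hV L (fun _ => D) (fun _ => le_rfl)
  convert this using 2
  ext z
  constructor
  · rintro ⟨⟨p, hp, he⟩, hz⟩
    refine ⟨fun k => D.lower (show z k ≤ p from ?_) hp, (hL z).1 ⟨p, hp, he ▸ cle_refl _⟩, hz⟩
    have := cle_infl σ (fun k => (z k).1) k
    rw [← he] at this
    exact this
  · rintro ⟨-, h, hz⟩
    obtain ⟨p, hp, he⟩ := (hL z).2 h
    have hlt := comp_lt (α := fun k => (z k).1) h2 (fun k => (z k).2.2) ⟨0, by omega⟩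
    exact ⟨⟨⟨infl σ (fun k => (z k).1), hC _ p.2.1 _ he, by omega⟩, D.lower he hp, rfl⟩, hz⟩

theorem isDec_of_infl {σ p : PermAny} (h : IsInfl σ p) : IsDec σ p := exists_good h

theorem IsDec.isInfl {σ p : PermAny} (h : IsDec σ p) : IsInfl σ p := by
  obtain ⟨α, h0, -, rfl⟩ := h
  exact ⟨_, (infl_spec σ α).blk h0⟩

theorem gf_two (hC : IsPermClass C) {σ : PermAny} (hσ : IsSimplePerm σ.2) (h2 : 2 ≤ σ.1)
    (D : LowerSet (NC C)) :
    gf nsz (D : Set (NC C)) = gf nsz ((D : Set (NC C)) ∩ KK C σ) +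
      gf (fun z : Fin σ.1 → NC C => ∑ k, nsz (z k)) (tup σ D) := by
  rw [← gf_part hC hσ h2, ← gf_union nsz_finite]
  · congr 1
    ext p
    constructor
    · intro hp
      by_cases h : IsInfl σ p.1
      · exact Or.inr ⟨hp, isDec_of_infl h⟩
      · exact Or.inl ⟨hp, h⟩
    · rintro (h | h)
      · exact h.1
      · exact h.1
  · rw [Set.disjoint_left]
    rintro p ⟨-, h⟩ ⟨-, h'⟩
    exact h h'.isInfl

theorem gf_all (hC : IsPermClass C) (S : Finset PermAny)
    (hS : ∀ σ ∈ S, IsSimplePerm σ.2 ∧ 2 ≤ σ.1)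
    (hS' : ∀ σ ∈ C, IsSimplePerm σ.2 → 2 ≤ σ.1 → σ ∈ S) (D : LowerSet (NC C)) :
    gf nsz (D : Set (NC C)) = gf nsz {p : NC C | p ∈ D ∧ p.1.1 = 1} +
      ∑ σ ∈ S, gf (fun z : Fin σ.1 → NC C => ∑ k, nsz (z k)) (tup σ D) := by
  have h1 : ∑ σ ∈ S, gf (fun z : Fin σ.1 → NC C => ∑ k, nsz (z k)) (tup σ D) =
      ∑ σ ∈ S, gf nsz {p : NC C | p ∈ D ∧ IsDec σ p.1} :=
    Finset.sum_congr rfl fun σ h => (gf_part hC (hS σ h).1 (hS σ h).2 D).symm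
  rw [h1, ← gf_biUnion nsz_finite, ← gf_union nsz_finite]
  · congr 1
    ext p
    constructor
    · intro hp
      by_cases h : p.1.1 = 1
      · exact Or.inl ⟨hp, h⟩
      · right
        obtain ⟨σ, α, h2, hs, h0, hg, he⟩ := exists_decomp p.1 (by have := p.2.2; omega)
        refine ⟨σ, hS' σ (hC p.1 p.2.1 σ ?_) hs h2, hp, α, h0, hg, he⟩
        have := cle_infl' σ α h0
        rw [← he] at this
        exact this
    · rintro (h | ⟨_, _, h⟩)
      · exact h.1
      · exact h.1
  · rw [Set.disjoint_left]
    rintro p ⟨-, h⟩ ⟨σ, hσ, -, α, h0, hg, he⟩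
    have hlt := comp_lt (hS σ hσ).2 h0 ⟨0, by have := (hS σ hσ).2; omega⟩
    have := h0 ⟨0, by have := (hS σ hσ).2; omega⟩
    rw [← he] at hlt
    omega
  · intro σ hσ τ hτ hne
    rw [Set.disjoint_left]
    rintro p ⟨-, α, h0, hg, he⟩ ⟨-, β, h0', hg', he'⟩
    have := infl_unique (hS σ hσ).1 (hS τ hτ).1 (hS σ hσ).2 (hS τ hτ).2 h0 h0' hg hg'
      (he.symm.trans he')
    exact hne (Sigma.mk.inj this).1

theorem gf_one (D : LowerSet (NC C)) :
    gf nsz {p : NC C | p ∈ D ∧ p.1.1 = 1} = 0 ∨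
      gf nsz {p : NC C | p ∈ D ∧ p.1.1 = 1} = PowerSeries.X := by
  by_cases h : ∃ p : NC C, p ∈ D ∧ p.1.1 = 1
  · right
    obtain ⟨p, hp, h1⟩ := h
    have hsing : {p : NC C | p ∈ D ∧ p.1.1 = 1} = {p} := by
      ext q
      constructor
      · rintro ⟨hq, h1'⟩
        exact Subtype.ext (cle_antisymm (cle_of_one h1' p.2.2) (cle_of_one h1 q.2.2))
      · rintro rfl
        exact ⟨hp, h1⟩
    rw [hsing]
    ext n
    rw [gf, coeff_mk, coeff_X]
    split_ifs with hn
    · have : {s : NC C | s ∈ ({p} : Set (NC C)) ∧ nsz s = n} = {p} := by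
        ext s
        constructor
        · rintro ⟨h, -⟩
          exact h
        · rintro rfl
          exact ⟨rfl, h1.trans hn.symm⟩
      rw [this]; simp
    · have : {s : NC C | s ∈ ({p} : Set (NC C)) ∧ nsz s = n} = ∅ := by
        ext s
        simp only [Set.mem_empty_iff_false, iff_false]
        rintro ⟨rfl, h⟩
        exact hn (h.symm.trans h1)
      rw [this]; simp
  · left
    have : {p : NC C | p ∈ D ∧ p.1.1 = 1} = ∅ := by
      ext q
      simp only [Set.mem_empty_iff_false, iff_false]
      exact fun hq => h ⟨q, hq⟩
    rw [this, gf_empty]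

theorem simple_two {σ : PermAny} (h : σ.1 = 2) : IsSimplePerm σ.2 := by
  rintro a b ⟨hab, -⟩
  have := a.2
  have := b.2
  rw [Fin.le_def] at hab
  rw [Fin.ext_iff]
  omega

/-- The increasing permutation of length two. -/
def s1 : PermAny := ⟨2, 1⟩
/-- The decreasing permutation of length two. -/
def s2 : PermAny := ⟨2, Equiv.swap 0 1⟩

theorem s1_ne_s2 : s1 ≠ s2 := by
  intro h
  have := eq_of_heq (Sigma.mk.inj h).2
  have := congrArg (fun e : Equiv.Perm (Fin 2) => e 0) this
  simp at this

theorem eq_s {σ : PermAny} (h : σ.1 = 2) : σ = s1 ∨ σ = s2 := by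
  obtain ⟨n, e⟩ := σ
  dsimp only at h
  subst h
  have : ∀ e : Equiv.Perm (Fin 2), e = 1 ∨ e = Equiv.swap 0 1 := by decide
  rcases this e with rfl | rfl
  · exact Or.inl rfl
  · exact Or.inr rfl

end
end AA

namespace AA
open Polynomial

section
variable {A : Type} [CommRing A] [Algebra A (PowerSeries ℚ)]

/-- Membership in the image of the coefficient ring. -/
def InA (A : Type) [CommRing A] [Algebra A (PowerSeries ℚ)] (f : PowerSeries ℚ) : Prop :=
  ∃ a : A, algebraMap A (PowerSeries ℚ) a = f

/-- The coefficient ring is algebraically closed in power series. -/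
def Clo (A : Type) [CommRing A] [Algebra A (PowerSeries ℚ)] : Prop :=
  ∀ (f : PowerSeries ℚ) (Q : Polynomial A), Q ≠ 0 → aeval f Q = 0 → InA A f

/-- Constant coefficient. -/
noncomputable def cc : A →+* ℚ :=
  (PowerSeries.constantCoeff (R := ℚ)).comp (algebraMap A (PowerSeries ℚ))

/-- Reduction of the coefficients. -/
noncomputable def phi : Polynomial A →+* ℚ[X] := Polynomial.mapRingHom cc

theorem phi_coeff (P : Polynomial A) (n : ℕ) : (phi P).coeff n = cc (P.coeff n) := by
  simp [phi]

theorem al_aeval {f : PowerSeries ℚ} (hf : InA A f) (Q : Polynomial A) : InA A (aeval f Q) := by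
  obtain ⟨a, rfl⟩ := hf
  exact ⟨aeval a Q, (Polynomial.aeval_algebraMap_apply (PowerSeries ℚ) a Q).symm⟩

theorem const_aeval {f : PowerSeries ℚ} (hf : PowerSeries.constantCoeff f = 0)
    (Q : Polynomial A) :
    PowerSeries.constantCoeff (aeval f Q) = (phi Q).coeff 0 := by
  rw [phi_coeff]
  induction Q using Polynomial.induction_on' with
  | add p q hp hq => simp [hp, hq]
  | monomial n a =>
    rw [aeval_monomial, map_mul, map_pow, hf, coeff_monomial]
    by_cases hn : n = 0
    · subst hn; simp [cc]
    · simp [hn]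

theorem al_div (hA : Clo A) {f g : PowerSeries ℚ} (hf : InA A f)
    (hf0 : PowerSeries.constantCoeff f = 0)
    {M N : Polynomial A} (hM : (phi M).coeff 0 = 1) (h : g * aeval f M = aeval f N) : InA A g := by
  have h2 : aeval f M ≠ 0 := by
    intro h0
    have := const_aeval hf0 M
    rw [h0, hM] at this
    simp at this
  obtain ⟨m, hm⟩ := al_aeval hf M
  obtain ⟨n, hn⟩ := al_aeval hf N
  refine hA g (C m * X - C n) ?_ ?_
  · intro h0
    have := congrArg (fun Q => Q.coeff 1) h0
    simp [coeff_C] at this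
    rw [this, map_zero] at hm
    exact h2 hm.symm
  · simp only [map_sub, map_mul, aeval_C, aeval_X, hm, hn]
    linear_combination h

theorem alg_main (hA : Clo A) {f g1 g2 : PowerSeries ℚ} (hf0 : PowerSeries.constantCoeff f = 0)
    {P M1 N1 M2 N2 : Polynomial A}
    (hP0 : (phi P).coeff 0 = 0) (hP1 : (phi P).coeff 1 = 0)
    (hM1 : (phi M1).coeff 0 = 1) (hM2 : (phi M2).coeff 0 = 1)
    (hN1 : (phi N1).coeff 0 = 0) (hN2 : (phi N2).coeff 0 = 0)
    (hN1' : (phi N1).coeff 1 = 1) (hN2' : (phi N2).coeff 1 = 1)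
    (e1 : g1 * aeval f M1 = aeval f N1) (e2 : g2 * aeval f M2 = aeval f N2)
    (e : f = (f - g1) + (f - g2) + aeval f P) : InA A f ∧ InA A g1 ∧ InA A g2 := by
  have hf : InA A f := by
    refine hA f ((X + P) * M1 * M2 - N1 * M2 - N2 * M1) ?_ ?_
    · intro h0
      have := congrArg (fun Q => (phi Q).coeff 1) h0
      have hX : phi (X : Polynomial A) = X := by simp [phi]
      simp [mul_coeff_one, mul_coeff_zero, hP0, hP1, hM1, hM2, hN1, hN2, hN1', hN2', hX] at this
    · simp only [map_sub, map_mul, map_add, aeval_X]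
      linear_combination (-aeval f M1 * aeval f M2) * e + aeval f M2 * e1 + aeval f M1 * e2
  exact ⟨hf, al_div hA hf hf0 hM1 e1, al_div hA hf hf0 hM2 e2⟩

/-- Values at `f` of polynomials with prescribed order. -/
noncomputable def VV (A : Type) [CommRing A] [Algebra A (PowerSeries ℚ)] (f : PowerSeries ℚ) (m : ℕ) : AddSubgroup (PowerSeries ℚ) :=
  (Submodule.toAddSubgroup (Ideal.comap phi (Ideal.span {X ^ m}))).map
    ((aeval f : Polynomial A →ₐ[A] PowerSeries ℚ) : Polynomial A →+ PowerSeries ℚ)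

theorem mem_VV {f v : PowerSeries ℚ} {m : ℕ} :
    v ∈ VV A f m ↔ ∃ P : Polynomial A, X ^ m ∣ phi P ∧ aeval f P = v := by
  simp only [VV, AddSubgroup.mem_map]
  constructor
  · rintro ⟨P, h, e⟩
    exact ⟨P, Ideal.mem_span_singleton.1 h, e⟩
  · rintro ⟨P, h, e⟩
    exact ⟨P, Ideal.mem_span_singleton.2 h, e⟩

theorem prod_VV {f : PowerSeries ℚ} {m : ℕ} (v : Fin m → PowerSeries ℚ) (h : ∀ k, v k ∈ VV A f 1) :
    ∏ k, v k ∈ VV A f m := by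
  have : ∀ k, ∃ P : Polynomial A, X ^ 1 ∣ phi P ∧ aeval f P = v k := fun k => mem_VV.1 (h k)
  choose P hP e using this
  refine mem_VV.2 ⟨∏ k, P k, ?_, ?_⟩
  · rw [map_prod]
    have := Finset.prod_dvd_prod_of_dvd (s := Finset.univ) _ _ (fun k _ => hP k)
    simpa using this
  · rw [map_prod]
    exact Finset.prod_congr rfl fun k _ => e k

theorem VV_mono {f : PowerSeries ℚ} {m n : ℕ} (h : m ≤ n) : VV A f n ≤ VV A f m := by
  intro v hv
  obtain ⟨P, hP, e⟩ := mem_VV.1 hv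
  exact mem_VV.2 ⟨P, (pow_dvd_pow _ h).trans hP, e⟩

theorem self_VV (f : PowerSeries ℚ) : f ∈ VV A f 1 := mem_VV.2 ⟨X, by simp [phi], by simp⟩

theorem const_VV {f v : PowerSeries ℚ} (hv : InA A v) (h0 : PowerSeries.constantCoeff v = 0) (m : ℕ) :
    v ∈ VV A f m := by
  obtain ⟨a, rfl⟩ := hv
  refine mem_VV.2 ⟨C a, ?_, ?_⟩
  · have : cc a = 0 := h0
    simp [phi, this]
  · rw [aeval_C]

theorem smul_VV {f v w : PowerSeries ℚ} {m : ℕ} (hv : InA A v)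
    (h0 : PowerSeries.constantCoeff v = 0) (hw : w ∈ VV A f 1) : v * w ∈ VV A f m := by
  obtain ⟨P, hP, e⟩ := mem_VV.1 hw
  obtain ⟨a, rfl⟩ := hv
  refine mem_VV.2 ⟨C a * P, ?_, ?_⟩
  · have : cc a = 0 := h0
    simp [phi, this]
  · rw [map_mul, aeval_C, e]

theorem VV_coeff {f v : PowerSeries ℚ} {m : ℕ} (h : v ∈ VV A f m) :
    ∃ P : Polynomial A, (∀ k < m, (phi P).coeff k = 0) ∧ aeval f P = v := by
  obtain ⟨P, hP, e⟩ := mem_VV.1 h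
  exact ⟨P, fun k hk => X_pow_dvd_iff.1 hP k hk, e⟩

/-- Values linear in `g`. -/
noncomputable def WW (A : Type) [CommRing A] [Algebra A (PowerSeries ℚ)] (f g : PowerSeries ℚ) : AddSubgroup (PowerSeries ℚ) :=
  (VV A f 1).map (AddMonoidHom.mulLeft g) ⊔ VV A f 2

theorem WW_spec {f g : PowerSeries ℚ} (h : f - g ∈ WW A f g) :
    ∃ M N : Polynomial A, (phi M).coeff 0 = 1 ∧ (phi N).coeff 0 = 0 ∧ (phi N).coeff 1 = 1 ∧
      g * aeval f M = aeval f N := by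
  obtain ⟨u, ⟨u', hu, rfl⟩, w, hw, e⟩ := AddSubgroup.mem_sup.1 h
  obtain ⟨U, hU, rfl⟩ := VV_coeff hu
  obtain ⟨W, hW, rfl⟩ := VV_coeff hw
  have hX : phi (X : Polynomial A) = X := by simp [phi]
  refine ⟨1 + U, X - W, ?_, ?_, ?_, ?_⟩
  · simp [hU 0 (by norm_num)]
  · simp [hX, hW 0 (by norm_num)]
  · simp [hX, hW 1 (by norm_num)]
  · simp only [AddMonoidHom.coe_mulLeft] at e
    simp only [map_add, map_sub, map_one, aeval_X]
    linear_combination e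

theorem WW_mul {f g x y : PowerSeries ℚ}
    (hx : x = g ∨ (InA A x ∧ PowerSeries.constantCoeff x = 0)) (hy : y ∈ VV A f 1) :
    x * y ∈ WW A f g := by
  rcases hx with rfl | ⟨h1, h2⟩
  · exact AddSubgroup.mem_sup_left ⟨y, hy, rfl⟩
  · exact AddSubgroup.mem_sup_right (smul_VV h1 h2 hy)

end

/-- Algebraic power series. -/
noncomputable def AL : Subalgebra ℚ[X] (PowerSeries ℚ) :=
  Subalgebra.algebraicClosure ℚ[X] (PowerSeries ℚ)

theorem clo_AL : Clo AL := by
  intro f Q h0 h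
  have h1 : IsAlgebraic AL f := ⟨Q, h0, h⟩
  have : Algebra.IsAlgebraic ℚ[X] AL :=
    inferInstanceAs (Algebra.IsAlgebraic ℚ[X] (Subalgebra.algebraicClosure ℚ[X] (PowerSeries ℚ)))
  have h2 : f ∈ AL := h1.restrictScalars ℚ[X]
  exact ⟨⟨f, h2⟩, rfl⟩

theorem X_AL : InA AL PowerSeries.X :=
  ⟨algebraMap ℚ[X] AL X, by
    rw [← IsScalarTower.algebraMap_apply]
    simp [PowerSeries.algebraMap_apply']⟩

theorem isAlg_of_InA {f : PowerSeries ℚ} (h : InA AL f) : IsAlgebraic ℚ[X] f := by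
  obtain ⟨a, rfl⟩ := h
  exact a.2
end AA

namespace AA

section
variable {C : Set PermAny} 

theorem gf_nsz_const (S : Set (NC C)) : PowerSeries.constantCoeff (gf nsz S) = 0 :=
  gf_const fun s _ => s.2.2

/-- The inductive claim. -/
def Claim (D : LowerSet (NC C)) : Prop :=
  InA AL (gf nsz (D : Set (NC C))) ∧
    ∀ σ : PermAny, σ.1 = 2 → InA AL (gf nsz ((D : Set (NC C)) ∩ KK C σ))

theorem fac_VV {D : LowerSet (NC C)} (ih : ∀ E, E < D → Claim E) {E : LowerSet (NC C)}
    (h : E ≤ D) : gf nsz (E : Set (NC C)) ∈ VV AL (gf nsz (D : Set (NC C))) 1 := by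
  rcases h.eq_or_lt with rfl | h
  · exact self_VV _
  · exact const_VV (ih E h).1 (gf_nsz_const _) 1

theorem tup_WW (hC : IsPermClass C) (hwqo : WellQuasiOrderedLE (NC C)) {D : LowerSet (NC C)}
    (ih : ∀ E, E < D → Claim E) (e : Equiv.Perm (Fin 2)) :
    gf nsz (D : Set (NC C)) - gf nsz ((D : Set (NC C)) ∩ KK C ⟨2, e⟩) ∈
      WW AL (gf nsz (D : Set (NC C))) (gf nsz ((D : Set (NC C)) ∩ KK C ⟨2, e⟩)) := by
  have h1 := gf_two hC (σ := ⟨2, e⟩) (simple_two rfl) le_rfl D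
  rw [sub_eq_of_eq_add' h1]
  refine gf_tup_mem hC hwqo ⟨2, e⟩ le_rfl D _ fun E hE => ?_
  have h0 : KB C ⟨2, e⟩ (0 : Fin 2) = KK C ⟨2, e⟩ := by
    ext p; simp [KB, KK]
  have h1 : KB C ⟨2, e⟩ (1 : Fin 2) = Set.univ := by
    ext p; simp [KB]
  have hp := Fin.prod_univ_two (fun k : Fin 2 => gf nsz ((E k : Set (NC C)) ∩ KB C ⟨2, e⟩ k))
  rw [h0, h1, Set.inter_univ] at hp
  refine Eq.subst (motive := fun x => x ∈ WW AL _ _) hp.symm ?_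
  refine WW_mul ?_ (fac_VV ih (hE _))
  rcases (hE (0 : Fin 2)).eq_or_lt with h | h
  · left; rw [h]
  · exact Or.inr ⟨(ih _ h).2 _ rfl, gf_nsz_const _⟩

theorem tup_VV (hC : IsPermClass C) (hwqo : WellQuasiOrderedLE (NC C)) {D : LowerSet (NC C)}
    (ih : ∀ E, E < D → Claim E) {σ : PermAny} (h3 : 3 ≤ σ.1) :
    gf (fun z : Fin σ.1 → NC C => ∑ k, nsz (z k)) (tup σ D) ∈
      VV AL (gf nsz (D : Set (NC C))) 2 := by
  refine gf_tup_mem hC hwqo σ (by omega) D _ fun E hE => ?_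
  refine VV_mono (show 2 ≤ σ.1 by omega) (prod_VV _ fun k => ?_)
  have : KB C σ k = Set.univ := by
    ext p
    simp only [KB, Set.mem_univ, iff_true]
    intro h
    omega
  rw [this, Set.inter_univ]
  exact fac_VV ih (hE k)

theorem claim (hC : IsPermClass C)
    (hfin : {p : PermAny | p ∈ C ∧ IsSimplePerm p.2}.Finite) (D : LowerSet (NC C)) : Claim D := by
  classical
  have hwqo := nc_wqo C hC hfin
  have hwf := lowerSet_wf (N := NC C)
  induction D using hwf.wf.induction with
  | _ D ih =>
  set S3 : Finset PermAny := hfin.toFinset.filter fun p => 3 ≤ p.1 with hS3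
  have hm1 : s1 ∉ insert s2 S3 := by
    rw [Finset.mem_insert, not_or]
    exact ⟨s1_ne_s2, by simp [hS3, s1]⟩
  have hm2 : s2 ∉ S3 := by
    simp [hS3, s2]
  have hall := gf_all hC (insert s1 (insert s2 S3)) (fun σ h => by
      rw [Finset.mem_insert, Finset.mem_insert, hS3, Finset.mem_filter,
        Set.Finite.mem_toFinset] at h
      rcases h with rfl | rfl | ⟨h, h3⟩
      · exact ⟨simple_two rfl, le_rfl⟩
      · exact ⟨simple_two rfl, le_rfl⟩
      · exact ⟨h.2, by omega⟩)
    (fun σ h h' h2 => by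
      rw [Finset.mem_insert, Finset.mem_insert, hS3, Finset.mem_filter,
        Set.Finite.mem_toFinset]
      by_cases h3 : σ.1 = 2
      · rcases eq_s h3 with h | h
        · exact Or.inl h
        · exact Or.inr (Or.inl h)
      · exact Or.inr (Or.inr ⟨⟨h, h'⟩, by omega⟩)) D
  rw [Finset.sum_insert hm1, Finset.sum_insert hm2] at hall
  have t1 := gf_two hC (σ := s1) (simple_two rfl) le_rfl D
  have t2 := gf_two hC (σ := s2) (simple_two rfl) le_rfl D
  obtain ⟨M1, N1, a1, b1, c1, e1⟩ := WW_spec (tup_WW hC hwqo ih 1)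
  obtain ⟨M2, N2, a2, b2, c2, e2⟩ := WW_spec (tup_WW hC hwqo ih (Equiv.swap 0 1))
  have hone : gf nsz {p : NC C | p ∈ D ∧ p.1.1 = 1} ∈ VV AL (gf nsz (D : Set (NC C))) 2 := by
    rcases gf_one D with h | h
    · rw [h]; exact AddSubgroup.zero_mem _
    · refine const_VV ?_ (gf_nsz_const _) 2
      rw [h]; exact X_AL
  have hrest := AddSubgroup.add_mem _ hone (AddSubgroup.sum_mem _ (t := S3)
    (f := fun σ => gf (fun z : Fin σ.1 → NC C => ∑ k, nsz (z k)) (tup σ D)) fun σ hσ =>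
      tup_VV hC hwqo ih (σ := σ) (Finset.mem_filter.1 hσ).2)
  obtain ⟨P, hP, eP⟩ := VV_coeff hrest
  obtain ⟨r1, r2, r3⟩ := alg_main clo_AL (gf_nsz_const _) (hP 0 (by norm_num)) (hP 1 (by norm_num))
    a1 a2 b1 b2 c1 c2 e1 e2 (by
      rw [eP]
      change _ = _ - gf nsz ((D : Set (NC C)) ∩ KK C s1) +
        (_ - gf nsz ((D : Set (NC C)) ∩ KK C s2)) + _
      linear_combination hall - t1 - t2)
  refine ⟨r1, fun σ hσ => ?_⟩
  rcases eq_s hσ with rfl | rfl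
  · exact r2
  · exact r3

theorem total_alg (C : Set PermAny) (hC : IsPermClass C)
    (hfin : {p : PermAny | p ∈ C ∧ IsSimplePerm p.2}.Finite) :
    IsAlgebraic (Polynomial ℚ)
      (PowerSeries.mk fun n => ({p : PermAny | p ∈ C ∧ p.1 = n}.ncard : ℚ)) := by
  have h := isAlg_of_InA (claim hC hfin ⊤).1
  have h2 : (PowerSeries.mk fun n => ({p : PermAny | p ∈ C ∧ p.1 = n}.ncard : ℚ)) =
      gf nsz ((⊤ : LowerSet (NC C)) : Set (NC C)) +
      algebraMap (Polynomial ℚ) (PowerSeries ℚ)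
        (Polynomial.C ({p : PermAny | p ∈ C ∧ p.1 = 0}.ncard : ℚ)) := by
    rw [← gf_image (sz := nsz) (sz' := fun p : PermAny => p.1) (fun p : NC C => p.1)
      Subtype.val_injective.injOn (fun _ _ => rfl)]
    ext n
    simp only [gf, PowerSeries.coeff_mk, map_add, PowerSeries.algebraMap_apply']
    by_cases hn : n = 0
    · subst hn
      have : {s : PermAny | s ∈ (fun p : NC C => p.1) '' ((⊤ : LowerSet (NC C)) : Set (NC C)) ∧
          s.1 = 0} = ∅ := by
        ext s
        simp only [Set.mem_empty_iff_false, iff_false]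
        rintro ⟨⟨p, -, rfl⟩, h⟩
        exact absurd p.2.2 (by simp only at h; omega)
      rw [this]
      simp
    · have : {s : PermAny | s ∈ (fun p : NC C => p.1) '' ((⊤ : LowerSet (NC C)) : Set (NC C)) ∧
          s.1 = n} = {p : PermAny | p ∈ C ∧ p.1 = n} := by
        ext s
        constructor
        · rintro ⟨⟨p, -, rfl⟩, h⟩
          exact ⟨p.2.1, h⟩
        · rintro ⟨h, h'⟩
          exact ⟨⟨⟨s, h, by omega⟩, trivial, rfl⟩, h'⟩
      rw [this]
      simp [PowerSeries.coeff_C, hn]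
  rw [h2]
  exact h.add (isAlgebraic_algebraMap _)

theorem exists_bivariate {F : PowerSeries ℚ} (h : IsAlgebraic (Polynomial ℚ) F) :
    ∃ P : MvPolynomial (Fin 2) ℚ, P ≠ 0 ∧
      MvPolynomial.aeval
        (fun i : Fin 2 => if i = 0 then (PowerSeries.X : PowerSeries ℚ) else F) P = 0 := by
  obtain ⟨p, hp0, hp⟩ := h
  let θ : Polynomial (Polynomial ℚ) →+* MvPolynomial (Fin 2) ℚ :=
    Polynomial.eval₂RingHom (Polynomial.eval₂RingHom MvPolynomial.C (MvPolynomial.X 0))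
      (MvPolynomial.X 1)
  let ψ : MvPolynomial (Fin 2) ℚ →+* Polynomial (Polynomial ℚ) :=
    MvPolynomial.eval₂Hom (Polynomial.C.comp Polynomial.C)
      (fun i : Fin 2 => if i = 0 then Polynomial.C Polynomial.X else Polynomial.X)
  have h1 : ψ.comp θ = RingHom.id _ := by
    ext <;> simp [ψ, θ]
  have h2 : (MvPolynomial.aeval
        (fun i : Fin 2 => if i = 0 then (PowerSeries.X : PowerSeries ℚ) else F)).toRingHom.comp θ =
      (Polynomial.aeval F).toRingHom := by
    ext <;> simp [θ, PowerSeries.algebraMap_apply']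
  refine ⟨θ p, ?_, ?_⟩
  · intro h0
    apply hp0
    have := RingHom.congr_fun h1 p
    simp only [RingHom.comp_apply, h0, map_zero, RingHom.id_apply] at this
    exact this.symm
  · exact (RingHom.congr_fun h2 p).trans hp

end
end AA

/-- A permutation class with only finitely many simple permutations
has an algebraic generating function: there is a nonzero bivariate polynomial
`P` over `ℚ` with `P(x, f(x)) = 0` as formal power series, where
`f(x) = Σ cₙ xⁿ` and `cₙ` is the number of length-`n` members of the class. -/
theorem algebraic_genfun_of_finitely_many_simples
    (C : Set PermAny) (hC : IsPermClass C)
    (hfin : {p : PermAny | p ∈ C ∧ IsSimplePerm p.2}.Finite) :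
    ∃ P : MvPolynomial (Fin 2) ℚ, P ≠ 0 ∧
      MvPolynomial.aeval
        (fun i : Fin 2 =>
          if i = 0 then (PowerSeries.X : PowerSeries ℚ)
          else PowerSeries.mk fun n => ({p : PermAny | p ∈ C ∧ p.1 = n}.ncard : ℚ))
        P = 0 := by
  exact AA.exists_bivariate (AA.total_alg C hC hfin)
end

section
/- Let B be a finite nonempty set of permutations and π a permutation of length k, and suppose the entry π(r) is ES⁺-reducible for π with respect to B. Then every element b of the basis of G_r(π), i.e., every minimal element b (in the componentwise order) of ℕ^{k+1} ∖ G_r(π), satisfies ‖b‖ ≤ ‖B‖∞ − 1. -/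
/-- partial sums of a gap vector -/
def gapSum {k : ℕ} (g : Fin (k + 1) → ℕ) (s : ℕ) : ℕ :=
  ∑ j ∈ Finset.univ.filter fun j : Fin (k + 1) => (j : ℕ) ≤ s, g j

theorem gapSum_zero {k : ℕ} (g : Fin (k + 1) → ℕ) : gapSum g 0 = g 0 := by
  unfold gapSum
  have : (Finset.univ.filter fun j : Fin (k + 1) => (j : ℕ) ≤ 0) = {0} := by
    ext j
    simp only [Finset.mem_filter, Finset.mem_univ, true_and, Finset.mem_singleton, Fin.ext_iff,
      Fin.val_zero]
    omega
  rw [this]; simp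

theorem gapSum_succ {k : ℕ} (g : Fin (k + 1) → ℕ) (s : ℕ) (hs : s + 1 < k + 1) :
    gapSum g (s + 1) = gapSum g s + g ⟨s + 1, hs⟩ := by
  unfold gapSum
  have : (Finset.univ.filter fun j : Fin (k + 1) => (j : ℕ) ≤ s + 1) =
      insert ⟨s + 1, hs⟩ (Finset.univ.filter fun j : Fin (k + 1) => (j : ℕ) ≤ s) := by
    ext j; simp [Fin.ext_iff]; omega
  rw [this, Finset.sum_insert (by simp)]
  omega

theorem gapSum_last {k : ℕ} (g : Fin (k + 1) → ℕ) (s : ℕ) (hs : k ≤ s) :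
    gapSum g s = ∑ j, g j := by
  unfold gapSum
  congr 1
  ext j; simp; omega

theorem gapSum_mono {k : ℕ} (g : Fin (k + 1) → ℕ) {s t : ℕ} (h : s ≤ t) :
    gapSum g s ≤ gapSum g t := by
  unfold gapSum
  apply Finset.sum_le_sum_of_subset
  intro j; simp; omega

theorem gapSum_delGap {k : ℕ} (g : Fin (k + 2) → ℕ) (r : Fin (k + 1)) (s : ℕ) (hs : s < k + 1) :
    gapSum (delGap g r) s = if s < (r : ℕ) then gapSum g s else gapSum g (s + 1) := by
  have hr := r.2
  induction s with
  | zero =>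
    rw [gapSum_zero, gapSum_succ g 0 (by omega), gapSum_zero]
    unfold delGap
    by_cases h : 0 < (r : ℕ)
    · simp [h]
    · have h0 : (r : ℕ) = 0 := by omega
      rw [if_neg (by simpa using h), if_pos (by simp [h0]), if_neg h]
      rfl
  | succ s ih =>
    rw [gapSum_succ _ s hs, ih (by omega), gapSum_succ g s (by omega),
      gapSum_succ g (s + 1) (by omega), gapSum_succ g s (by omega)]
    unfold delGap
    simp only [Fin.castSucc_mk, Fin.succ_mk]
    by_cases h1 : s + 1 < (r : ℕ)
    · have h2 : s < (r : ℕ) := by omega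
      simp [h1, h2]
    · by_cases h2 : s + 1 = (r : ℕ)
      · have h3 : s < (r : ℕ) := by omega
        simp [← h2]; omega
      · have h3 : ¬ s < (r : ℕ) := by omega
        simp [h1, h2, h3]

theorem gapSum_update {k : ℕ} (g : Fin (k + 1) → ℕ) (j : Fin (k + 1)) (hj : 0 < g j) (s : ℕ) :
    (if s < (j : ℕ) then gapSum (Function.update g j (g j - 1)) s
      else gapSum (Function.update g j (g j - 1)) s + 1) = gapSum g s := by
  unfold gapSum
  by_cases h : s < (j : ℕ)
  · rw [if_pos h]
    apply Finset.sum_congr rfl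
    intro x hx
    simp at hx
    rw [Function.update_of_ne]
    rintro rfl; omega
  · rw [if_neg h]
    have hm : j ∈ (Finset.univ.filter fun j : Fin (k + 1) => (j : ℕ) ≤ s) := by
      simp; omega
    rw [Finset.sum_update_of_mem hm, ← Finset.add_sum_erase _ _ hm, Finset.erase_eq]
    omega

/-- `p` has its smallest entries placed as prescribed by `π` and `g`. -/
def Shape {k n : ℕ} (π : Equiv.Perm (Fin k)) (g : Fin (k + 1) → ℕ) (p : Equiv.Perm (Fin n)) :
    Prop :=
  ∀ r : Fin k, ∀ i : Fin n, (i : ℕ) = gapSum g r + (r : ℕ) → (p i : ℕ) = (π r : ℕ)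

def ZN (B : Set PermAny) {k : ℕ} (π : Equiv.Perm (Fin k)) (g : Fin (k + 1) → ℕ) (n : ℕ) :
    Set (Equiv.Perm (Fin n)) :=
  {p | (⟨n, p⟩ : PermAny) ∈ AvSet B ∧ Shape π g p}

theorem ZSet_nonempty (B : Set PermAny) {k : ℕ} (π : Equiv.Perm (Fin k)) (g : Fin (k + 1) → ℕ)
    (n : ℕ) (hn : n = k + ∑ j, g j) : (ZSet B π g).Nonempty ↔ (ZN B π g n).Nonempty := by
  subst hn; rfl

theorem ZSet_ncard (B : Set PermAny) {k : ℕ} (π : Equiv.Perm (Fin k)) (g : Fin (k + 1) → ℕ)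
    (n : ℕ) (hn : n = k + ∑ j, g j) : (ZSet B π g).ncard = (ZN B π g n).ncard := by
  subst hn; rfl

theorem succAbove_val {n : ℕ} (p : Fin (n + 1)) (i : Fin n) :
    ((p.succAbove i : Fin (n + 1)) : ℕ) = if (i : ℕ) < (p : ℕ) then (i : ℕ) else (i : ℕ) + 1 := by
  unfold Fin.succAbove
  simp only [Fin.lt_def, Fin.val_castSucc]
  split_ifs <;> simp

theorem delEntry_spec {n : ℕ} (p : Equiv.Perm (Fin (n + 1))) (i : Fin (n + 1)) (j : Fin n) :
    (p i).succAbove (delEntry p i j) = p (i.succAbove j) := by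
  have h := Equiv.removeNone_some
    ((finSuccEquiv' i).symm.trans (p.trans (finSuccEquiv' (p i)))) (x := j) (by
      have hne : p (i.succAbove j) ≠ p i := by simp [Fin.succAbove_ne]
      obtain ⟨y, hy⟩ := Fin.exists_succAbove_eq hne
      exact ⟨y, by simp [← hy]⟩)
  have h2 : some (delEntry p i j) = finSuccEquiv' (p i) (p (i.succAbove j)) := by
    unfold delEntry
    rw [h]; simp
  rw [← finSuccEquiv'_symm_some, h2, Equiv.symm_apply_apply]

theorem delEntry_inj {n : ℕ} (p p' : Equiv.Perm (Fin (n + 1))) (i : Fin (n + 1))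
    (h1 : p i = p' i) (h2 : delEntry p i = delEntry p' i) : p = p' := by
  ext x : 1
  rcases Fin.eq_self_or_eq_succAbove i x with rfl | ⟨j, rfl⟩
  · exact h1
  · rw [← delEntry_spec, ← delEntry_spec, h1, h2]

theorem exists_insert {n : ℕ} (q : Equiv.Perm (Fin n)) (i v : Fin (n + 1)) :
    ∃ p : Equiv.Perm (Fin (n + 1)), p i = v ∧ delEntry p i = q := by
  refine ⟨(finSuccEquiv' i).trans ((Equiv.optionCongr q).trans (finSuccEquiv' v).symm), ?_, ?_⟩
  · simp
  · ext j : 1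
    set p := (finSuccEquiv' i).trans ((Equiv.optionCongr q).trans (finSuccEquiv' v).symm)
    have hv : p i = v := by simp [p]
    have h := delEntry_spec p i j
    rw [hv] at h
    apply Fin.succAbove_right_injective (p := v)
    rw [h]; simp [p]

theorem contains_del {m n : ℕ} (β : Equiv.Perm (Fin m)) (p : Equiv.Perm (Fin (n + 1)))
    (i : Fin (n + 1)) (f : Fin m → Fin (n + 1)) (hf : StrictMono f)
    (hfp : ∀ a b : Fin m, β a < β b ↔ p (f a) < p (f b)) (hi : ∀ a, f a ≠ i) :
    ContainsPat β (delEntry p i) := by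
  choose e he using fun a => Fin.exists_succAbove_eq (hi a)
  refine ⟨e, ?_, ?_⟩
  · intro a b hab
    have := hf hab
    rw [← he a, ← he b] at this
    exact (Fin.strictMono_succAbove i).lt_iff_lt.1 this
  · intro a b
    rw [hfp, ← he a, ← he b, ← delEntry_spec, ← delEntry_spec]
    exact (Fin.strictMono_succAbove _).lt_iff_lt

theorem del_lt_iff {n : ℕ} (p : Equiv.Perm (Fin (n + 1))) (i : Fin (n + 1)) (a b : Fin n) :
    delEntry p i a < delEntry p i b ↔ p (i.succAbove a) < p (i.succAbove b) := by
  rw [← delEntry_spec, ← delEntry_spec]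
  exact (Fin.strictMono_succAbove _).lt_iff_lt.symm

theorem ContainsPat.trans' {a b c : ℕ} {x : Equiv.Perm (Fin a)} {y : Equiv.Perm (Fin b)}
    {z : Equiv.Perm (Fin c)} (h : ContainsPat x y) (h' : ContainsPat y z) : ContainsPat x z := by
  obtain ⟨f, hf, h1⟩ := h
  obtain ⟨e, he, h2⟩ := h'
  exact ⟨e ∘ f, he.comp hf, fun u v => by rw [h1, h2]; rfl⟩

theorem contains_self_del {n : ℕ} (p : Equiv.Perm (Fin (n + 1))) (i : Fin (n + 1)) :
    ContainsPat (delEntry p i) p :=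
  ⟨i.succAbove, Fin.strictMono_succAbove i, del_lt_iff p i⟩

/-- positions after removing entry `r` -/
theorem pos_del {k n : ℕ} (g : Fin (k + 2) → ℕ) (r : Fin (k + 1)) (i : Fin (n + 1))
    (hi : (i : ℕ) = gapSum g r + r) (s : Fin k) (x : Fin n) :
    (x : ℕ) = gapSum (delGap g r) s + s ↔
      ((i.succAbove x : Fin (n + 1)) : ℕ) =
        gapSum g (r.succAbove s : Fin (k + 1)) + (r.succAbove s : Fin (k + 1)) := by
  rw [succAbove_val, succAbove_val, gapSum_delGap g r s (by omega), hi]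
  by_cases h : (s : ℕ) < (r : ℕ)
  · rw [if_pos h, if_pos h]
    have := gapSum_mono g h.le
    split_ifs <;> omega
  · rw [if_neg h, if_neg h]
    have := gapSum_mono g (s := r) (t := s + 1) (by omega)
    split_ifs <;> omega

theorem shape_del {k n : ℕ} (π : Equiv.Perm (Fin (k + 1))) (g : Fin (k + 2) → ℕ)
    (r : Fin (k + 1)) (p : Equiv.Perm (Fin (n + 1))) (i : Fin (n + 1))
    (hi : (i : ℕ) = gapSum g r + r) (hp : Shape π g p) :
    Shape (delEntry π r) (delGap g r) (delEntry p i) := by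
  intro s x hx
  have h1 := hp _ _ ((pos_del g r i hi s x).1 hx)
  have h2 := hp _ _ hi
  rw [← delEntry_spec, ← delEntry_spec, succAbove_val, succAbove_val, h2] at h1
  split_ifs at h1 <;> omega

theorem shape_ins {k n : ℕ} (π : Equiv.Perm (Fin (k + 1))) (g : Fin (k + 2) → ℕ)
    (r : Fin (k + 1)) (p : Equiv.Perm (Fin (n + 1))) (i : Fin (n + 1))
    (hi : (i : ℕ) = gapSum g r + r) (hv : (p i : ℕ) = π r)
    (hp : Shape (delEntry π r) (delGap g r) (delEntry p i)) : Shape π g p := by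
  intro s x hx
  rcases Fin.eq_self_or_eq_succAbove r s with rfl | ⟨t, rfl⟩
  · have : x = i := Fin.ext (by omega)
    rw [this, hv]
  · rcases Fin.eq_self_or_eq_succAbove i x with rfl | ⟨y, rfl⟩
    · exfalso
      rw [hx, succAbove_val] at hi
      split_ifs at hi with h
      · have := gapSum_mono g h.le
        omega
      · have := gapSum_mono g (s := r) (t := t + 1) (by omega)
        omega
    · have := hp _ _ ((pos_del g r i hi t y).2 hx)
      rw [← delEntry_spec, ← delEntry_spec, succAbove_val, succAbove_val, hv, this]

theorem shape_big {m n : ℕ} (π : Equiv.Perm (Fin m)) (g : Fin (m + 1) → ℕ)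
    (p : Equiv.Perm (Fin (n + 1))) (hn : n + 1 = m + ∑ j, g j) (hp : Shape π g p)
    (l : Fin (n + 1)) (hl : m ≤ (p l : ℕ)) :
    ∃ a : Fin (m + 1) → ℕ, a < g ∧ n = m + ∑ j, a j ∧ Shape π a (delEntry p l) := by
  classical
  have hne : ∀ s : Fin m, (l : ℕ) ≠ gapSum g s + s := by
    intro s h
    have := hp s l h
    omega
  have hex : ∃ j : ℕ, j = m ∨ (l : ℕ) ≤ gapSum g j + j := ⟨m, Or.inl rfl⟩
  obtain ⟨j, hj, hjmin⟩ : ∃ j : ℕ, (j = m ∨ (l : ℕ) ≤ gapSum g j + j) ∧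
      ∀ s < j, ¬ (s = m ∨ (l : ℕ) ≤ gapSum g s + s) :=
    ⟨Nat.find hex, Nat.find_spec hex, fun s hs => Nat.find_min hex hs⟩
  have hjm : j ≤ m := by
    by_contra h
    exact hjmin m (by omega) (Or.inl rfl)
  have hlj : (l : ℕ) < gapSum g j + j := by
    rcases Nat.lt_or_ge j m with h | h
    · have := hne ⟨j, h⟩
      simp only at this
      omega
    · have : j = m := by omega
      subst this
      rw [gapSum_last g j le_rfl]
      omega
  have hpos : 0 < g ⟨j, by omega⟩ := by
    rcases j with _ | j
    · rw [gapSum_zero] at hlj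
      have : g ⟨0, by omega⟩ = g 0 := rfl
      omega
    · have h1 := hjmin j (by omega)
      rw [gapSum_succ g j (by omega)] at hlj
      omega
  have hT := gapSum_update g ⟨j, by omega⟩ hpos
  simp only at hT
  set a := Function.update g ⟨j, by omega⟩ (g ⟨j, by omega⟩ - 1) with ha
  refine ⟨a, ?_, ?_, ?_⟩
  · rw [ha]
    exact update_lt_self_iff.2 (by omega)
  · have := hT m
    rw [if_neg (by omega), gapSum_last _ m le_rfl, gapSum_last _ m le_rfl] at this
    omega
  · intro s x hx
    have hs := hT s
    have h1 : ((l.succAbove x : Fin (n + 1)) : ℕ) = gapSum g s + s := by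
      rw [succAbove_val]
      by_cases h : (s : ℕ) < j
      · have := hjmin s h
        rw [if_pos h] at hs
        rw [if_pos (by omega)]
        omega
      · have := gapSum_mono g (s := j) (t := s) (by omega)
        rw [if_neg h] at hs
        rw [if_neg (by omega)]
        omega
    have h2 := hp _ _ h1
    rw [← delEntry_spec, succAbove_val] at h2
    have := (π s).2
    split_ifs at h2 <;> omega

theorem sum_delGap {k : ℕ} (g : Fin (k + 2) → ℕ) (r : Fin (k + 1)) :
    ∑ j, delGap g r j = ∑ j, g j := by
  rw [← gapSum_last (delGap g r) k le_rfl, gapSum_delGap g r k (by omega),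
    if_neg (by omega), gapSum_last g (k + 1) le_rfl]

/-- With ES⁺-reducibility, deletion is onto wherever `Z(B;π;a)` is nonempty. -/
theorem ins_avoids (B : Set PermAny) {k n : ℕ} (π : Equiv.Perm (Fin (k + 1)))
    (r : Fin (k + 1)) (hred : ESPlusRed B π r) (a : Fin (k + 2) → ℕ)
    (hn : n + 1 = (k + 1) + ∑ j, a j) (ha : (ZSet B π a).Nonempty)
    (p : Equiv.Perm (Fin (n + 1))) (i : Fin (n + 1)) (hi : (i : ℕ) = gapSum a r + r)
    (hp : Shape π a p) (hq : (⟨n, delEntry p i⟩ : PermAny) ∈ AvSet B) :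
    (⟨n + 1, p⟩ : PermAny) ∈ AvSet B := by
  have hc := hred a ha
  rw [ZSet_ncard B π a (n + 1) hn,
    ZSet_ncard B _ (delGap a r) n (by rw [sum_delGap]; omega)] at hc
  have hmaps : ∀ x ∈ ZN B π a (n + 1), delEntry x i ∈ ZN B (delEntry π r) (delGap a r) n := by
    intro x hx
    refine ⟨fun β hβ hcon => hx.1 β hβ (hcon.trans' (contains_self_del x i)),
      shape_del π a r x i hi hx.2⟩
  have hinj : Set.InjOn (fun x => delEntry x i) (ZN B π a (n + 1)) := by
    intro x hx y hy hxy
    apply delEntry_inj x y i _ hxy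
    apply Fin.ext
    rw [hx.2 r i hi, hy.2 r i hi]
  have himg : (fun x => delEntry x i) '' ZN B π a (n + 1) =
      ZN B (delEntry π r) (delGap a r) n := by
    apply Set.eq_of_subset_of_ncard_le
    · rintro _ ⟨x, hx, rfl⟩
      exact hmaps x hx
    · rw [hinj.ncard_image, hc]
    · exact Set.toFinite _
  have hmem : delEntry p i ∈ ZN B (delEntry π r) (delGap a r) n :=
    ⟨hq, shape_del π a r p i hi hp⟩
  rw [← himg] at hmem
  obtain ⟨x, hx, hxp⟩ := hmem
  have : x = p := by
    apply delEntry_inj x p i _ hxp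
    apply Fin.ext
    rw [hx.2 r i hi, hp r i hi]
  exact this ▸ hx.1

theorem pos_lt {k n : ℕ} (g : Fin (k + 2) → ℕ) (hn : n = (k + 1) + ∑ j, g j)
    (r : Fin (k + 1)) : gapSum g r + r < n := by
  have := gapSum_mono g (s := r) (t := k + 1) (by omega)
  have h2 : gapSum g (k + 1) = ∑ j : Fin (k + 2), g j := gapSum_last g (k + 1) le_rfl
  omega

theorem exists_big {n m M : ℕ} (p : Equiv.Perm (Fin n)) (f : Fin M → Fin n) (x : Fin M)
    (hx : (p (f x) : ℕ) < m) (hc : m + M ≤ n) : ∃ l : Fin n, m ≤ (p l : ℕ) ∧ ∀ y, f y ≠ l := by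
  classical
  by_contra hcon
  push Not at hcon
  have hsub : (Finset.univ.image fun y : Fin n => p y) ⊆
      (Finset.univ.filter fun v : Fin n => (v : ℕ) < m) ∪
        ((Finset.univ.erase x).image fun y => p (f y)) := by
    intro v hv
    simp only [Finset.mem_image, Finset.mem_univ, true_and] at hv
    obtain ⟨y, rfl⟩ := hv
    by_cases h : (p y : ℕ) < m
    · simp [h]
    · obtain ⟨z, rfl⟩ := hcon y (by omega)
      have : z ≠ x := by rintro rfl; exact h hx
      simp only [Finset.mem_union, Finset.mem_image, Finset.mem_erase]
      exact Or.inr ⟨z, ⟨this, Finset.mem_univ _⟩, rfl⟩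
  have h1 := Finset.card_le_card hsub
  have h2 := Finset.card_union_le (Finset.univ.filter fun v : Fin n => (v : ℕ) < m)
    ((Finset.univ.erase x).image fun y => p (f y))
  have h3 : ((Finset.univ.erase x).image fun y => p (f y)).card ≤ M - 1 := by
    refine Finset.card_image_le.trans ?_
    rw [Finset.card_erase_of_mem (Finset.mem_univ _)]; simp
  have h4 : (Finset.univ.filter fun v : Fin n => (v : ℕ) < m).card ≤ m := by
    have h5 : ((Finset.univ.filter fun v : Fin n => (v : ℕ) < m).image
        (fun v : Fin n => (v : ℕ))) ⊆ Finset.range m := by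
      intro v; simp only [Finset.mem_image, Finset.mem_filter, Finset.mem_range]
      rintro ⟨w, ⟨_, hw⟩, rfl⟩; exact hw
    have := Finset.card_le_card h5
    rwa [Finset.card_image_of_injective _ Fin.val_injective, Finset.card_range] at this
  rw [Finset.card_image_of_injective _ p.injective, Finset.card_univ, Fintype.card_fin] at h1
  have := x.2
  omega

/-- If the entry `π r` is ES⁺-reducible with respect to a finite
nonempty basis `B` with maximum length `N = ‖B‖∞`, then every minimal element
`b` (componentwise) of the complement of `G_r(π)` satisfies `‖b‖ ≤ ‖B‖∞ − 1`. -/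
theorem basis_of_GrSet_bounded
    (B : Set PermAny) (hBfin : B.Finite) (hBne : B.Nonempty)
    (N : ℕ) (hN : IsGreatest ((fun p : PermAny => p.1) '' B) N)
    {k : ℕ} (π : Equiv.Perm (Fin (k + 1))) (r : Fin (k + 1))
    (hred : ESPlusRed B π r)
    (b : Fin (k + 2) → ℕ) (hb : b ∉ GrSet B π r)
    (hmin : ∀ a : Fin (k + 2) → ℕ, a < b → a ∈ GrSet B π r) :
    (∑ j, b j) ≤ N - 1 := by
  have hb' : ¬ (ZSet B π b).Nonempty ∧ (ZSet B (delEntry π r) (delGap b r)).Nonempty := by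
    have : ∃ h : Fin (k + 2) → ℕ, h ≤ b ∧
        ¬ ((ZSet B π h).Nonempty ∨ ZSet B (delEntry π r) (delGap h r) = ∅) := by
      by_contra hcon
      push Not at hcon
      exact hb fun h hh => by
        by_contra h2
        push Not at h2
        rcases hcon h hh with h3 | h3
        · exact absurd h3 (by rw [h2.1]; exact Set.not_nonempty_empty)
        · exact absurd h3 (by simpa [Set.nonempty_iff_ne_empty] using h2.2)
    obtain ⟨h, hle, hh⟩ := this
    rcases hle.lt_or_eq with hlt | rfl
    · exact absurd (hmin h hlt h le_rfl) hh
    · rw [not_or] at hh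
      exact ⟨hh.1, Set.nonempty_iff_ne_empty.2 hh.2⟩
  obtain ⟨hemp, hne⟩ := hb'
  have hsb : (∑ j : Fin (k + 1 + 1), b j) = ∑ j : Fin (k + 2), b j := rfl
  obtain ⟨n, hn⟩ : ∃ n, n = k + ∑ j, b j := ⟨_, rfl⟩
  rw [ZSet_nonempty B _ _ n (by rw [sum_delGap]; exact hn)] at hne
  rw [ZSet_nonempty B _ _ (n + 1) (by omega)] at hemp
  obtain ⟨q, hqA, hqS⟩ := hne
  have hposlt := pos_lt b (n := n + 1) (by omega) r
  obtain ⟨i, hi⟩ : ∃ i : Fin (n + 1), (i : ℕ) = gapSum b r + r := ⟨⟨_, hposlt⟩, rfl⟩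
  have hrk := (π r).2
  obtain ⟨p, hpi, hpq⟩ := exists_insert q i ⟨π r, by omega⟩
  have hpv : (p i : ℕ) = π r := by rw [hpi]
  have hpS : Shape π b p := shape_ins π b r p i hi hpv (hpq.symm ▸ hqS)
  have hpA : ¬ (⟨n + 1, p⟩ : PermAny) ∈ AvSet B := fun h => hemp ⟨p, h, hpS⟩
  unfold AvSet at hpA
  simp only [Set.mem_ofPred_eq, not_forall, not_not] at hpA
  obtain ⟨β, hβ, f, hf, hfp⟩ := hpA
  have hlen : β.1 ≤ N := hN.2 ⟨β, hβ, rfl⟩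
  -- the copy of `β` uses position `i`
  have hhit : ∃ x, f x = i := by
    by_contra hcon
    push Not at hcon
    exact hqA β hβ (hpq ▸ contains_del β.2 p i f hf hfp hcon)
  obtain ⟨x, hx⟩ := hhit
  by_contra hbig
  obtain ⟨l, hl, hlf⟩ := exists_big (m := k + 1) p f x (by rw [hx, hpv]; exact hrk)
    (by have := x.2; omega)
  obtain ⟨a, hab, hna, haS⟩ := shape_big π b p (by omega) hpS l hl
  have hsa : (∑ j : Fin (k + 1 + 1), a j) = ∑ j : Fin (k + 2), a j := rfl
  obtain ⟨n, rfl⟩ : ∃ n', n = n' + 1 := ⟨n - 1, by omega⟩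
  have hil : i ≠ l := by rw [← hx]; exact hlf x
  obtain ⟨i', hi'⟩ := Fin.exists_succAbove_eq hil
  have hi'v : (delEntry p l i' : ℕ) = π r := by
    have h := congrArg Fin.val (delEntry_spec p l i')
    rw [succAbove_val, hi', hpv] at h
    split_ifs at h <;> omega
  have hi'pos : (i' : ℕ) = gapSum a r + r := by
    have h1 := pos_lt a hna r
    have h2 := haS r ⟨_, h1⟩ rfl
    have h3 : i' = ⟨_, h1⟩ := (delEntry p l).injective (Fin.ext (hi'v.trans h2.symm))
    rw [h3]
  have hcont : ContainsPat (delEntry (delEntry p l) i') q := by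
    rw [← hpq]
    refine contains_del _ p i (fun y => l.succAbove (i'.succAbove y))
      ((Fin.strictMono_succAbove l).comp (Fin.strictMono_succAbove i')) ?_ ?_
    · intro u v
      rw [del_lt_iff, del_lt_iff]
    · intro u h
      rw [← hi'] at h
      exact Fin.succAbove_ne i' u (Fin.succAbove_right_injective h)
  have hq' : (⟨n, delEntry (delEntry p l) i'⟩ : PermAny) ∈ AvSet B :=
    fun γ hγ hc => hqA γ hγ (hc.trans' hcont)
  have hane : (ZSet B π a).Nonempty := by
    rcases hmin a hab a le_rfl with h | h
    · exact h
    · exfalso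
      have h2 : (ZN B (delEntry π r) (delGap a r) n).Nonempty :=
        ⟨_, hq', shape_del π a r _ i' hi'pos haS⟩
      rw [← ZSet_nonempty B _ _ n (by rw [sum_delGap]; omega), h] at h2
      exact Set.not_nonempty_empty h2
  exact ins_avoids B π r hred a hna hane _ i' hi'pos haS hq' β hβ
    (contains_del β.2 p l f hf hfp hlf)
end

section
/- Let B be a finite set of permutations and C = Av(B). For π ∈ C of length m, let D(π) = {σ ∈ C : the subsequence of σ consisting of its values 1,…,m, read left to right, forms the word π(1)⋯π(m)} (the set of descendants of π in the pattern-avoidance tree T(B)), and say σ is a child of τ if σ is obtained from τ by inserting a new maximum value into some position. Say π ≃ π' if there is a bijection φ : D(π) → D(π') with φ(π) = π' such that for all τ, τ' ∈ D(π), τ' is a child of τ if and only if φ(τ') is a child of φ(τ) (i.e., the subtrees T(B;π) and T(B;π') are isomorphic as rooted trees). Then ≃ has only finitely many equivalence classes on C (equivalently, T(B) is isomorphic to a finitely labeled generating tree) if and only if both of the following hold: there exist n and a permutation obtained by inserting n+1 into the increasing permutation 12⋯n that does not lie in C, and there exist n and a permutation obtained by inserting n+1 into the decreasing permutation n⋯21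 that does not lie in C. -/
/-- Transport a permutation along an equality of lengths. -/
def castPerm {m n : ℕ} (h : m = n) (p : Equiv.Perm (Fin m)) : Equiv.Perm (Fin n) :=
  (finCongr h).permCongr p

/-- `σ` is a child of `τ`: `σ` is obtained from `τ` by inserting a new maximum
value; equivalently, deleting the maximum entry of `σ` yields `τ`. -/
def IsChild (σ τ : PermAny) : Prop :=
  ∃ h : σ.1 = τ.1 + 1,
    delEntry (castPerm h σ.2) ((castPerm h σ.2).symm (Fin.last τ.1)) = τ.2

/-- `q` is a descendant of the length-`m` permutation `π` in the
pattern-avoidance tree: the subsequence of `q` consisting of its `m` smallest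
values, read left to right, forms the word `π`. -/
def Descend {m : ℕ} (π : Equiv.Perm (Fin m)) (q : PermAny) : Prop :=
  m ≤ q.1 ∧ ∀ i i' : Fin q.1, ∀ hi : (q.2 i : ℕ) < m, ∀ hi' : (q.2 i' : ℕ) < m,
    i < i' → π.symm ⟨(q.2 i : ℕ), hi⟩ < π.symm ⟨(q.2 i' : ℕ), hi'⟩

/-- `D(π)`: the set of descendants of `p` in the pattern-avoidance tree `T(B)`. -/
def DSet (B : Set PermAny) (p : PermAny) : Set PermAny :=
  {q | q ∈ AvSet B ∧ Descend p.2 q}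

/-- The subtrees of the pattern-avoidance tree rooted at `p` and `p'` are
isomorphic as rooted trees: there is a bijection from `D(p)` onto `D(p')`
sending `p` to `p'` and preserving the child relation in both directions. -/
def TreeIso (B : Set PermAny) (p p' : PermAny) : Prop :=
  ∃ φ : PermAny → PermAny, Set.BijOn φ (DSet B p) (DSet B p') ∧ φ p = p' ∧
    ∀ τ ∈ DSet B p, ∀ τ' ∈ DSet B p,
      (IsChild τ' τ ↔ IsChild (φ τ') (φ τ))

namespace FLGT

/-- position of the value `v` in the permutation `σ` (the identity beyond the length). -/
def pos (σ : PermAny) (v : ℕ) : ℕ :=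
  if h : v < σ.1 then (σ.2.symm ⟨v, h⟩ : ℕ) else v

lemma pos_eq {n : ℕ} (π : Equiv.Perm (Fin n)) (v : Fin n) :
    pos ⟨n, π⟩ v = (π.symm v : ℕ) := by
  simp [pos]

lemma pos_lt {σ : PermAny} {v : ℕ} (h : v < σ.1) : pos σ v < σ.1 := by
  simp [pos, h]

lemma pos_inj (σ : PermAny) : Function.Injective (pos σ) := by
  intro a b h
  unfold pos at h
  split_ifs at h with h1 h2 h2
  · have := σ.2.symm.injective (Fin.ext h)
    simpa using this
  · have := (σ.2.symm ⟨a, h1⟩).2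
    omega
  · have := (σ.2.symm ⟨b, h2⟩).2
    omega
  · exact h

lemma pos_image (σ : PermAny) : (Finset.range σ.1).image (pos σ) = Finset.range σ.1 := by
  apply Finset.eq_of_subset_of_card_le
  · intro x hx
    simp only [Finset.mem_image, Finset.mem_range] at hx ⊢
    obtain ⟨a, ha, rfl⟩ := hx
    exact pos_lt ha
  · rw [Finset.card_image_of_injective _ (pos_inj σ)]

lemma pos_surj (σ : PermAny) {i : ℕ} (h : i < σ.1) : ∃ v < σ.1, pos σ v = i := by
  have : i ∈ (Finset.range σ.1).image (pos σ) := by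
    rw [pos_image]; simpa using h
  simpa using this

/-- the orders on values below `n` agree. -/
def Agree (n : ℕ) (σ τ : PermAny) : Prop :=
  ∀ a b, a < n → b < n → (pos σ a < pos σ b ↔ pos τ a < pos τ b)

lemma perm_ext {σ τ : PermAny} (h : σ.1 = τ.1) (hA : Agree σ.1 σ τ) : σ = τ := by
  obtain ⟨n, π⟩ := σ
  obtain ⟨m, ρ⟩ := τ
  obtain rfl : n = m := h
  congr 1
  have hm : StrictMono (fun i : Fin n => ρ.symm (π i)) := by
    intro i j hij
    have := hA (π i) (π j) (π i).2 (π j).2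
    rw [pos_eq, pos_eq, pos_eq, pos_eq] at this
    simp only [Equiv.symm_apply_apply] at this
    exact this.1 hij
  have h2 : (fun i : Fin n => ρ.symm (π i)) = id := by
    have h3 := hm.range_inj (strictMono_id (α := Fin n))
    apply h3.1
    have : Function.Surjective (fun i : Fin n => ρ.symm (π i)) :=
      ρ.symm.surjective.comp π.surjective
    rw [this.range_eq]; simp
  ext i
  have := congrFun h2 i
  simp only [id] at this
  rw [Equiv.symm_apply_eq] at this
  rw [this]

lemma perm_exists {α : Type} [LinearOrder α] (n : ℕ) (f : ℕ → α)
    (hf : ∀ a b, a < n → b < n → f a = f b → a = b) :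
    ∃ σ : PermAny, σ.1 = n ∧ ∀ a b, a < n → b < n → (pos σ a < pos σ b ↔ f a < f b) := by
  refine ⟨⟨n, Tuple.sort (fun i : Fin n => f i)⟩, rfl, ?_⟩
  set s := Tuple.sort (fun i : Fin n => f i) with hs
  have hm : Monotone ((fun i : Fin n => f i) ∘ s) := Tuple.monotone_sort _
  have hst : StrictMono ((fun i : Fin n => f i) ∘ s) := by
    apply hm.strictMono_of_injective
    intro i j hij
    apply s.injective
    exact Fin.ext (hf _ _ (s i).2 (s j).2 hij)
  intro a b ha hb
  have h1 := pos_eq s ⟨a, ha⟩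
  have h2 := pos_eq s ⟨b, hb⟩
  simp only at h1 h2
  rw [h1, h2, ← Fin.lt_def, ← hst.lt_iff_lt]
  simp

/-- `g` embeds `σ` into `τ` (acting on values). -/
def Emb (g : ℕ → ℕ) (σ τ : PermAny) : Prop :=
  (∀ a b, a < b → b < σ.1 → g a < g b) ∧ (∀ a, a < σ.1 → g a < τ.1) ∧
  ∀ a b, a < σ.1 → b < σ.1 → (pos σ a < pos σ b ↔ pos τ (g a) < pos τ (g b))

lemma Emb.comp {g h : ℕ → ℕ} {σ τ υ : PermAny} (hg : Emb g σ τ) (hh : Emb h τ υ) :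
    Emb (h ∘ g) σ υ := by
  refine ⟨fun a b hab hb => hh.1 _ _ (hg.1 a b hab hb) (hg.2.1 b hb),
    fun a ha => hh.2.1 _ (hg.2.1 a ha), fun a b ha hb => ?_⟩
  rw [hg.2.2 a b ha hb, hh.2.2 _ _ (hg.2.1 a ha) (hg.2.1 b hb)]
  rfl

lemma contains_iff (β σ : PermAny) : ContainsPat β.2 σ.2 ↔ ∃ g, Emb g β σ := by
  obtain ⟨k, β⟩ := β
  obtain ⟨n, σ⟩ := σ
  constructor
  · rintro ⟨f, hf, hfb⟩
    refine ⟨fun a => if h : a < k then (σ (f (β.symm ⟨a, h⟩)) : ℕ) else 0, ?_, ?_, ?_⟩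
    · intro a b hab hb
      simp only at hb
      have ha : a < k := by omega
      simp only [ha, hb, dif_pos]
      rw [← Fin.lt_def, ← hfb]
      simpa using hab
    · intro a ha
      simp only at ha
      simp [ha]
    · intro a b ha hb
      simp only at ha hb
      simp only [ha, hb, dif_pos]
      rw [pos_eq, pos_eq, pos_eq β ⟨a, ha⟩, pos_eq β ⟨b, hb⟩]
      simp only [Equiv.symm_apply_apply]
      rw [← Fin.lt_def, ← Fin.lt_def, hf.lt_iff_lt]
  · rintro ⟨g, h1, h2, h3⟩
    simp only at h1 h2 h3
    refine ⟨fun i => σ.symm ⟨g (β i), h2 _ (β i).2⟩, ?_, ?_⟩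
    · intro i j hij
      have := h3 (β i) (β j) (β i).2 (β j).2
      rw [pos_eq, pos_eq, pos_eq σ ⟨g (β i), h2 _ (β i).2⟩,
        pos_eq σ ⟨g (β j), h2 _ (β j).2⟩] at this
      simp only [Equiv.symm_apply_apply] at this
      exact this.1 hij
    · intro a b
      simp only [Equiv.apply_symm_apply]
      have key : ∀ a b : Fin k, β a < β b → g (β a) < g (β b) :=
        fun a b h => h1 _ _ h (β b).2
      constructor
      · exact key a b
      · intro h
        by_contra hn
        rcases lt_or_eq_of_le (not_lt.1 hn) with h' | h'
        · have := key b a h'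
          have h'' : g (β a) < g (β b) := h
          omega
        · rw [h'] at h
          exact lt_irrefl _ h

lemma av_of_emb {B : Set PermAny} {g : ℕ → ℕ} {σ τ : PermAny} (h : Emb g σ τ)
    (hτ : τ ∈ AvSet B) : σ ∈ AvSet B := by
  intro b hb hc
  rw [contains_iff] at hc
  obtain ⟨f, hf⟩ := hc
  exact hτ b hb ((contains_iff _ _).2 ⟨_, hf.comp h⟩)

lemma sub_exists (τ : PermAny) (n : ℕ) (g : ℕ → ℕ) (h1 : ∀ a b, a < b → b < n → g a < g b)
    (h2 : ∀ a, a < n → g a < τ.1) : ∃ σ : PermAny, σ.1 = n ∧ Emb g σ τ := by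
  obtain ⟨σ, rfl, hσ⟩ := perm_exists n (fun a => pos τ (g a)) (by
    intro a b ha hb h
    have := pos_inj τ h
    rcases lt_trichotomy a b with h' | h' | h'
    · have := h1 a b h' hb; omega
    · exact h'
    · have := h1 b a h' ha; omega)
  exact ⟨σ, rfl, h1, h2, hσ⟩

lemma delEntry_spec {k : ℕ} (π : Equiv.Perm (Fin (k + 1))) (r : Fin (k + 1)) (i : Fin k) :
    π (r.succAbove i) = (π r).succAbove (delEntry π r i) := by
  set e := ((finSuccEquiv' r).symm.trans (π.trans (finSuccEquiv' (π r)))) with he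
  have h0 : e none = none := by simp [he]
  have h1 : some (delEntry π r i) = e (some i) := by
    apply Equiv.removeNone_some
    apply Option.ne_none_iff_exists'.1
    rw [← h0]
    exact fun h => by simpa using e.injective h
  have h2 : e (some i) = finSuccEquiv' (π r) (π (r.succAbove i)) := by simp [he]
  rw [h2] at h1
  have := congrArg (finSuccEquiv' (π r)).symm h1
  simpa using this.symm

lemma child_iff (σ τ : PermAny) : IsChild σ τ ↔ σ.1 = τ.1 + 1 ∧ Agree τ.1 σ τ := by
  obtain ⟨m, σ⟩ := σ
  obtain ⟨n, τ⟩ := τ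
  have main : ∀ σ : Equiv.Perm (Fin (n+1)),
      Agree n ⟨n+1, σ⟩ ⟨n, delEntry σ (σ.symm (Fin.last n))⟩ := by
    intro σ a b ha hb
    set δ := delEntry σ (σ.symm (Fin.last n)) with hδ
    have key : ∀ v : Fin n, (σ.symm (Fin.last n)).succAbove (δ.symm v) = σ.symm v.castSucc := by
      intro v
      have := delEntry_spec σ (σ.symm (Fin.last n)) (δ.symm v)
      rw [← hδ] at this
      simp only [Equiv.apply_symm_apply, Fin.succAbove_last] at this
      rw [← this]; simp
    have p1 := pos_eq δ ⟨a, ha⟩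
    have p2 := pos_eq δ ⟨b, hb⟩
    have p3 := pos_eq σ (Fin.castSucc ⟨a, ha⟩)
    have p4 := pos_eq σ (Fin.castSucc ⟨b, hb⟩)
    simp only [Fin.val_castSucc] at p1 p2 p3 p4
    rw [p1, p2, p3, p4, ← key, ← key, ← Fin.lt_def, ← Fin.lt_def,
      (Fin.strictMono_succAbove _).lt_iff_lt]
  constructor
  · rintro ⟨h, h2⟩
    simp only at h h2
    subst h
    refine ⟨rfl, ?_⟩
    have hc : castPerm rfl σ = σ := by ext; simp [castPerm]
    rw [hc] at h2
    rw [← h2]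
    exact main σ
  · rintro ⟨h, h2⟩
    simp only at h h2
    subst h
    refine ⟨rfl, ?_⟩
    have hc : castPerm rfl σ = σ := by ext; simp [castPerm]
    simp only [hc]
    have : (⟨n, delEntry σ (σ.symm (Fin.last n))⟩ : PermAny) = ⟨n, τ⟩ := by
      refine perm_ext (τ := ⟨n, τ⟩) rfl ?_
      intro a b ha hb
      rw [← main σ a b ha hb, h2 a b ha hb]
    simpa using this

lemma descend_iff (p q : PermAny) : Descend p.2 q ↔ p.1 ≤ q.1 ∧ Agree p.1 q p := by
  obtain ⟨m, π⟩ := p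
  obtain ⟨n, ρ⟩ := q
  constructor
  · rintro ⟨h, h2⟩
    simp only at h h2
    refine ⟨h, ?_⟩
    have key : ∀ a b, a < m → b < m → pos ⟨n, ρ⟩ a < pos ⟨n, ρ⟩ b →
        pos ⟨m, π⟩ a < pos ⟨m, π⟩ b := by
      intro a b ha hb hab
      have ha' : a < n := by omega
      have hb' : b < n := by omega
      have := h2 (ρ.symm ⟨a, ha'⟩) (ρ.symm ⟨b, hb'⟩) (by simpa using ha) (by simpa using hb)
        (by simpa [pos, ha', hb'] using hab)
      simpa [pos, ha, hb] using this
    intro a b ha hb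
    simp only at ha hb
    refine ⟨key a b ha hb, fun h => ?_⟩
    by_contra hn
    rcases lt_or_eq_of_le (not_lt.1 hn) with h' | h'
    · have := key b a hb ha h'; omega
    · rw [pos_inj _ h'] at h; omega
  · rintro ⟨h, h2⟩
    refine ⟨h, ?_⟩
    simp only at h h2
    intro i j hi hj hij
    simp only at hi hj hij ⊢
    have := (h2 _ _ hi hj).1 (by rw [pos_eq, pos_eq]; simpa using hij)
    simpa [pos, hi, hj] using this

lemma card_pos (p : PermAny) {c : ℕ} (hc : c ≤ p.1) :
    ((Finset.range p.1).filter (fun a => pos p a < c)).card = c := by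
  rw [← Finset.card_image_of_injective _ (pos_inj p)]
  have : ((Finset.range p.1).filter (fun a => pos p a < c)).image (pos p) = Finset.range c := by
    ext x
    simp only [Finset.mem_image, Finset.mem_filter, Finset.mem_range]
    constructor
    · rintro ⟨a, ⟨_, h⟩, rfl⟩; exact h
    · intro h
      obtain ⟨v, hv, rfl⟩ := pos_surj p (lt_of_lt_of_le h hc)
      exact ⟨v, ⟨hv, h⟩, rfl⟩
  rw [this, Finset.card_range]

/-- the gap (with respect to the values below `m`) in which the value `v` sits. -/
def gap (m : ℕ) (σ : PermAny) (v : ℕ) : ℕ :=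
  ((Finset.range m).filter (fun a => pos σ a < pos σ v)).card

lemma gap_le (m : ℕ) (σ : PermAny) (v : ℕ) : gap m σ v ≤ m :=
  (Finset.card_filter_le _ _).trans (by simp)

lemma gap_mono (m : ℕ) (σ : PermAny) {v w : ℕ} (h : pos σ v ≤ pos σ w) :
    gap m σ v ≤ gap m σ w := by
  apply Finset.card_le_card
  intro a
  simp only [Finset.mem_filter]
  exact fun ⟨h1, h2⟩ => ⟨h1, by omega⟩

lemma agree_le {n : ℕ} {σ τ : PermAny} (h : Agree n σ τ) {a b : ℕ} (ha : a < n) (hb : b < n) :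
    pos σ a ≤ pos σ b ↔ pos τ a ≤ pos τ b := by
  rw [← not_lt, ← not_lt, h b a hb ha]

lemma gap_iff {p σ : PermAny} (hA : Agree p.1 σ p) (v : ℕ) {a : ℕ} (ha : a < p.1) :
    pos σ a < pos σ v ↔ pos p a < gap p.1 σ v := by
  constructor
  · intro h
    have h1 := card_pos p (c := pos p a + 1) (pos_lt ha)
    have h2 : ((Finset.range p.1).filter (fun b => pos p b < pos p a + 1)).card
        ≤ gap p.1 σ v := by
      apply Finset.card_le_card
      intro b
      simp only [Finset.mem_filter, Finset.mem_range]
      rintro ⟨hb, hb2⟩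
      refine ⟨hb, ?_⟩
      have := (agree_le hA hb ha).2 (by omega)
      omega
    omega
  · intro h
    by_contra hn
    have h1 := card_pos p (c := pos p a) (pos_lt ha).le
    have h2 : gap p.1 σ v ≤ ((Finset.range p.1).filter (fun b => pos p b < pos p a)).card := by
      apply Finset.card_le_card
      intro b
      simp only [Finset.mem_filter, Finset.mem_range]
      rintro ⟨hb, hb2⟩
      exact ⟨hb, (hA b a hb ha).1 (by omega)⟩
    omega

/-- a gap of `p` is active. -/
def Active (B : Set PermAny) (p : PermAny) (c : ℕ) : Prop :=
  ∃ τ ∈ AvSet B, IsChild τ p ∧ gap p.1 τ p.1 = c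

lemma Active.le {B : Set PermAny} {p : PermAny} {c : ℕ} (h : Active B p c) : c ≤ p.1 := by
  obtain ⟨τ, _, _, rfl⟩ := h
  exact gap_le _ _ _

lemma finset_enum (T : Finset ℕ) : ∃ u : ℕ → ℕ, (∀ i j, i < j → j < T.card → u i < u j) ∧
    (∀ i, i < T.card → u i ∈ T) ∧ ∀ x ∈ T, ∃ i < T.card, u i = x := by
  refine ⟨fun i => if h : i < T.card then T.orderEmbOfFin rfl ⟨i, h⟩ else 0, ?_, ?_, ?_⟩
  · intro i j hij hj
    have hi : i < T.card := by omega
    simp only [hi, hj, dif_pos]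
    simpa using hij
  · intro i hi
    simp only [hi, dif_pos]
    exact Finset.orderEmbOfFin_mem _ _ _
  · intro x hx
    have : x ∈ Set.range (T.orderEmbOfFin rfl) := by
      rw [Finset.range_orderEmbOfFin]; exact hx
    obtain ⟨i, hi⟩ := this
    exact ⟨i, i.2, by simp [hi]⟩

lemma erdos_szekeres (r s : ℕ) : ∃ N : ℕ, ∀ (x : ℕ → ℕ) (S : Finset ℕ), Set.InjOn x S →
    N ≤ S.card → (∃ T ⊆ S, T.card = r ∧ StrictMonoOn x T) ∨
      (∃ T ⊆ S, T.card = s ∧ StrictAntiOn x T) := by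
  suffices H : ∀ t r s : ℕ, r + s = t → ∃ N : ℕ, ∀ (x : ℕ → ℕ) (S : Finset ℕ), Set.InjOn x S →
    N ≤ S.card → (∃ T ⊆ S, T.card = r ∧ StrictMonoOn x T) ∨
      (∃ T ⊆ S, T.card = s ∧ StrictAntiOn x T) from H _ r s rfl
  intro t
  induction t with
  | zero =>
    intro r s h
    obtain rfl : r = 0 := by omega
    exact ⟨0, fun x S _ _ => Or.inl ⟨∅, by simp, by simp, by simp [StrictMonoOn]⟩⟩
  | succ t ih =>
    intro r s h
    rcases Nat.eq_zero_or_pos r with rfl | hr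
    · exact ⟨0, fun x S _ _ => Or.inl ⟨∅, by simp, by simp, by simp [StrictMonoOn]⟩⟩
    rcases Nat.eq_zero_or_pos s with rfl | hs
    · exact ⟨0, fun x S _ _ => Or.inr ⟨∅, by simp, by simp, by simp [StrictAntiOn]⟩⟩
    obtain ⟨N1, h1⟩ := ih (r - 1) s (by omega)
    obtain ⟨N2, h2⟩ := ih r (s - 1) (by omega)
    refine ⟨N1 + N2 + 1, fun x S hinj hS => ?_⟩
    have hne : S.Nonempty := Finset.card_pos.1 (by omega)
    set i := S.min' hne with hi
    have hiS : i ∈ S := S.min'_mem hne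
    set U := (S.erase i).filter (fun j => x i < x j) with hU
    set V := (S.erase i).filter (fun j => ¬ x i < x j) with hV
    have hUV : U.card + V.card = S.card - 1 := by
      rw [hU, hV, Finset.card_filter_add_card_filter_not, Finset.card_erase_of_mem hiS]
    have hUS : U ⊆ S := (Finset.filter_subset _ _).trans (Finset.erase_subset _ _)
    have hVS : V ⊆ S := (Finset.filter_subset _ _).trans (Finset.erase_subset _ _)
    have hlt : ∀ j ∈ S, j ≠ i → i < j := fun j hj hne' =>
      lt_of_le_of_ne (S.min'_le j hj) (Ne.symm hne')
    by_cases hc : N1 ≤ U.card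
    · rcases h1 x U (hinj.mono (by exact_mod_cast hUS)) hc with ⟨T, hT, hTc, hTm⟩ | ⟨T, hT, hTc, hTm⟩
      · left
        have hUi : ∀ j ∈ T, i < j ∧ x i < x j := by
          intro j hj
          have := hT hj
          simp only [hU, Finset.mem_filter, Finset.mem_erase] at this
          exact ⟨hlt j this.1.2 this.1.1, this.2⟩
        refine ⟨insert i T, ?_, ?_, ?_⟩
        · exact Finset.insert_subset hiS (hT.trans hUS)
        · rw [Finset.card_insert_of_notMem (fun h => lt_irrefl _ (hUi i h).1)]; omega
        · intro a ha b hb hab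
          simp only [Finset.coe_insert, Set.mem_insert_iff, Finset.mem_coe] at ha hb
          rcases ha with rfl | ha <;> rcases hb with rfl | hb
          · omega
          · exact (hUi b hb).2
          · have := (hUi a ha).1; omega
          · exact hTm ha hb hab
      · right
        exact ⟨T, hT.trans hUS, hTc, hTm⟩
    · rcases h2 x V (hinj.mono (by exact_mod_cast hVS)) (by omega) with
        ⟨T, hT, hTc, hTm⟩ | ⟨T, hT, hTc, hTm⟩
      · left
        exact ⟨T, hT.trans hVS, hTc, hTm⟩
      · right
        have hUi : ∀ j ∈ T, i < j ∧ x j < x i := by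
          intro j hj
          have := hT hj
          simp only [hV, Finset.mem_filter, Finset.mem_erase] at this
          refine ⟨hlt j this.1.2 this.1.1, lt_of_le_of_ne (not_lt.1 this.2) ?_⟩
          intro he
          exact this.1.1 (hinj this.1.2 hiS he)
        refine ⟨insert i T, ?_, ?_, ?_⟩
        · exact Finset.insert_subset hiS (hT.trans hVS)
        · rw [Finset.card_insert_of_notMem (fun h => lt_irrefl _ (hUi i h).1)]; omega
        · intro a ha b hb hab
          simp only [Finset.coe_insert, Set.mem_insert_iff, Finset.mem_coe] at ha hb
          rcases ha with rfl | ha <;> rcases hb with rfl | hb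
          · omega
          · exact (hUi b hb).2
          · have := (hUi a ha).1; omega
          · exact hTm ha hb hab

lemma lt_of_mono {n : ℕ} {u : ℕ → ℕ} (hu : ∀ i j, i < j → j < n → u i < u j) {i j : ℕ}
    (hi : i < n) (hj : j < n) : u i < u j ↔ i < j := by
  constructor
  · intro h
    by_contra hn
    rcases lt_or_eq_of_le (not_lt.1 hn) with h' | h'
    · have := hu j i h' hi; omega
    · subst h'; omega
  · exact fun h => hu i j h hj

lemma children_av {B : Set PermAny} {p r : PermAny} {u g : ℕ → ℕ}
    (hu : ∀ i j, i < j → j < r.1 + 1 → u i < u j) (hact : ∀ i, i < r.1 + 1 → Active B p (u i))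
    (hg1 : ∀ a b, a < b → b < r.1 → g a < g b) (hg2 : ∀ a, a < r.1 → g a < p.1)
    (hg3 : ∀ a, a < r.1 → pos p (g a) = u (pos r a)) {q : PermAny} (hq : IsChild q r) :
    q ∈ AvSet B := by
  rw [child_iff] at hq
  obtain ⟨hq1, hq2⟩ := hq
  have hj := gap_le r.1 q r.1
  obtain ⟨τ, hτ, hτc, hτg⟩ := hact (gap r.1 q r.1) (by omega)
  rw [child_iff] at hτc
  obtain ⟨ht1, ht2⟩ := hτc
  have key : ∀ a, a < r.1 → (pos q a < pos q r.1 ↔ pos τ (g a) < pos τ p.1) := by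
    intro a ha
    rw [gap_iff hq2 r.1 ha, gap_iff ht2 p.1 (hg2 a ha), hτg, hg3 a ha,
      lt_of_mono hu (by have := pos_lt ha; omega) (by omega)]
  refine av_of_emb (g := fun a => if a < r.1 then g a else p.1) ⟨?_, ?_, ?_⟩ hτ
  · intro a b hab hb
    have ha : a < r.1 := by omega
    simp only [ha, if_true]
    split_ifs with h
    · exact hg1 a b hab h
    · exact hg2 a ha
  · intro a ha
    simp only
    split_ifs with h
    · have := hg2 a h; omega
    · omega
  · intro a b ha hb
    simp only
    split_ifs with h h' h'
    · rw [hq2 a b h h', ht2 _ _ (hg2 a h) (hg2 b h'), hg3 a h, hg3 b h',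
        lt_of_mono hu (by have := pos_lt h; omega) (by have := pos_lt h'; omega)]
    · obtain rfl : b = r.1 := by omega
      exact key a h
    · obtain rfl : a = r.1 := by omega
      have h1 := key b h'
      have h2 : pos q b ≠ pos q r.1 := fun h => by have := pos_inj _ h; omega
      have h3 : pos τ (g b) ≠ pos τ p.1 := fun h => by
        have := pos_inj _ h; have := hg2 b h'; omega
      omega
    · obtain rfl : a = r.1 := by omega
      obtain rfl : b = r.1 := by omega
      simp

lemma pos_one {n a : ℕ} (ha : a < n) : pos ⟨n, 1⟩ a = a := by
  simp only [pos, ha, dif_pos]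
  rfl

lemma pos_rev {n a : ℕ} (ha : a < n) : pos ⟨n, Fin.revPerm⟩ a = n - 1 - a := by
  simp [pos, ha, Fin.val_rev]; omega

open Classical in
lemma active_bound {B : Set PermAny}
    (h1 : ∃ n : ℕ, ∃ q : PermAny, IsChild q ⟨n, 1⟩ ∧ q ∉ AvSet B)
    (h2 : ∃ n : ℕ, ∃ q : PermAny, IsChild q ⟨n, Fin.revPerm⟩ ∧ q ∉ AvSet B) :
    ∃ K : ℕ, ∀ p : PermAny, ((Finset.range (p.1 + 1)).filter (Active B p)).card ≤ K := by
  obtain ⟨n1, q1, hq1, hq1'⟩ := h1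
  obtain ⟨n2, q2, hq2, hq2'⟩ := h2
  obtain ⟨N, hN⟩ := erdos_szekeres n1 n2
  refine ⟨N, fun p => ?_⟩
  by_contra hlt
  set S := (Finset.range (p.1 + 1)).filter (Active B p) with hS
  have hne : S.Nonempty := Finset.card_pos.1 (by omega)
  set c := S.max' hne with hc
  have hcS : c ∈ S := S.max'_mem hne
  have hSa : ∀ i ∈ S, Active B p i := fun i hi => (Finset.mem_filter.1 hi).2
  have hcp := (hSa c hcS).le
  have hx : ∀ i, ∃ v, i < p.1 → v < p.1 ∧ pos p v = i := by
    intro i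
    by_cases h : i < p.1
    · obtain ⟨v, hv⟩ := pos_surj p h
      exact ⟨v, fun _ => hv⟩
    · exact ⟨0, fun h' => absurd h' h⟩
  choose x hx using hx
  have hlt' : ∀ i ∈ S.erase c, i < c := fun i hi =>
    lt_of_le_of_ne (S.le_max' i (Finset.mem_of_mem_erase hi)) (Finset.ne_of_mem_erase hi)
  have hinj : Set.InjOn x (S.erase c) := by
    intro i hi j hj hij
    have h1 := hlt' i hi
    have h2 := hlt' j hj
    rw [← (hx i (by omega)).2, ← (hx j (by omega)).2, hij]
  have gen : ∀ T ⊆ S.erase c, ∃ u : ℕ → ℕ, (∀ i j, i < j → j < T.card + 1 → u i < u j) ∧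
      (∀ i, i < T.card + 1 → Active B p (u i)) ∧ (∀ i, i < T.card → u i ∈ T) := by
    intro T hT
    obtain ⟨u, hu1, hu2, -⟩ := finset_enum T
    refine ⟨fun i => if i < T.card then u i else c, ?_, ?_, ?_⟩
    · intro i j hij hj
      have hi : i < T.card := by omega
      simp only [hi, if_true]
      split_ifs with h
      · exact hu1 i j hij h
      · exact hlt' _ (hT (hu2 i hi))
    · intro i hi
      simp only
      split_ifs with h
      · exact hSa _ (Finset.mem_of_mem_erase (hT (hu2 i h)))
      · exact hSa c hcS
    · intro i hi
      simp only [hi, if_true]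
      exact hu2 i hi
  rcases hN x (S.erase c) hinj (by rw [Finset.card_erase_of_mem hcS]; omega) with
    ⟨T, hT, rfl, hTm⟩ | ⟨T, hT, rfl, hTm⟩
  · obtain ⟨u, hu1, hu2, hu3⟩ := gen T hT
    have hup : ∀ i, i < T.card → u i < p.1 := fun i hi => by
      have := hlt' _ (hT (hu3 i hi)); omega
    refine hq1' (children_av (r := ⟨T.card, 1⟩) (g := fun a => x (u a)) hu1 hu2 ?_ ?_ ?_ hq1)
    · intro a b hab hb
      simp only at hb
      exact hTm (hu3 a (by omega)) (hu3 b hb) (hu1 a b hab (by omega))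
    · intro a ha
      exact (hx _ (hup a ha)).1
    · intro a ha
      rw [pos_one ha]
      exact (hx _ (hup a ha)).2
  · obtain ⟨u, hu1, hu2, hu3⟩ := gen T hT
    have hup : ∀ i, i < T.card → u i < p.1 := fun i hi => by
      have := hlt' _ (hT (hu3 i hi)); omega
    refine hq2' (children_av (r := ⟨T.card, Fin.revPerm⟩)
      (g := fun a => x (u (T.card - 1 - a))) hu1 hu2 ?_ ?_ ?_ hq2)
    · intro a b hab hb
      simp only at hb
      exact hTm (hu3 _ (by omega)) (hu3 _ (by omega)) (hu1 _ _ (by omega) (by omega))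
    · intro a ha
      simp only at ha
      exact (hx _ (hup _ (by omega))).1
    · intro a ha
      rw [pos_rev ha]
      simp only at ha
      exact (hx _ (hup _ (by omega))).2

lemma child_exists (p : PermAny) {c : ℕ} (hc : c ≤ p.1) :
    ∃ q, IsChild q p ∧ gap p.1 q p.1 = c := by
  obtain ⟨q, hq1, hq2⟩ := perm_exists (p.1 + 1)
    (fun a => if a < p.1 then 2 * pos p a + 1 else 2 * c) (by
      intro a b ha hb h
      split_ifs at h with h1 h2 h2
      · exact pos_inj p (by omega)
      all_goals omega)
  refine ⟨q, (child_iff _ _).2 ⟨hq1, ?_⟩, ?_⟩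
  · intro a b ha hb
    rw [hq2 a b (by omega) (by omega)]
    simp only [ha, hb, if_true]
    omega
  · rw [← card_pos p hc]
    unfold gap
    congr 1
    apply Finset.filter_congr
    intro a ha
    rw [Finset.mem_range] at ha
    rw [hq2 a _ (by omega) (by omega)]
    simp only [ha, if_true, lt_irrefl, if_false]
    omega

lemma emb_of_child {q p : PermAny} (h : IsChild q p) : Emb id p q := by
  rw [child_iff] at h
  refine ⟨fun a b h _ => h, fun a ha => by simp only [id]; omega, fun a b ha hb => ?_⟩
  exact (h.2 a b ha hb).symm

lemma mem_DSet {B : Set PermAny} {p q : PermAny} :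
    q ∈ DSet B p ↔ q ∈ AvSet B ∧ p.1 ≤ q.1 ∧ Agree p.1 q p := by
  unfold DSet
  rw [Set.mem_ofPred_eq, descend_iff]

/-- the children of `p` in the tree. -/
def Ch (B : Set PermAny) (p : PermAny) : Set PermAny := {q | q ∈ AvSet B ∧ IsChild q p}

lemma Ch_sub {B : Set PermAny} {p q : PermAny} (h : q ∈ Ch B p) : q ∈ DSet B p := by
  have := (child_iff _ _).1 h.2
  exact mem_DSet.2 ⟨h.1, by omega, this.2⟩

lemma finite_len (n : ℕ) : {q : PermAny | q.1 = n}.Finite := by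
  apply (Set.finite_range (fun π : Equiv.Perm (Fin n) => (⟨n, π⟩ : PermAny))).subset
  rintro ⟨m, π⟩ h
  obtain rfl : m = n := h
  exact ⟨π, rfl⟩

lemma Ch_finite (B : Set PermAny) (p : PermAny) : (Ch B p).Finite :=
  (finite_len (p.1 + 1)).subset fun _ h => ((child_iff _ _).1 h.2).1

lemma Ch_card {B : Set PermAny} {p p' : PermAny} (hp : p ∈ AvSet B) (h : TreeIso B p p') :
    (Ch B p).ncard ≤ (Ch B p').ncard := by
  obtain ⟨φ, hφ, hp', hc⟩ := h
  have hpD : p ∈ DSet B p := mem_DSet.2 ⟨hp, le_rfl, fun _ _ _ _ => Iff.rfl⟩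
  apply Set.ncard_le_ncard_of_injOn φ _ _ (Ch_finite _ _)
  · intro q hq
    refine ⟨(hφ.mapsTo (Ch_sub hq)).1, ?_⟩
    rw [← hp']
    exact (hc p hpD q (Ch_sub hq)).1 hq.2
  · intro a ha b hb hab
    exact hφ.injOn (Ch_sub ha) (Ch_sub hb) hab

lemma Ch_large {B : Set PermAny} {p : PermAny} (h : ∀ q, IsChild q p → q ∈ AvSet B) :
    p ∈ AvSet B ∧ p.1 < (Ch B p).ncard := by
  have hce : ∀ c : Fin (p.1 + 1), ∃ q, IsChild q p ∧ gap p.1 q p.1 = c :=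
    fun c => child_exists p (by omega)
  choose f hf using hce
  constructor
  · exact av_of_emb (emb_of_child (hf 0).1) (h _ (hf 0).1)
  · have h1 : (Set.range f).ncard ≤ (Ch B p).ncard := by
      apply Set.ncard_le_ncard _ (Ch_finite _ _)
      rintro _ ⟨c, rfl⟩
      exact ⟨h _ (hf c).1, (hf c).1⟩
    have hinj : Function.Injective f := by
      intro a b hab
      apply Fin.ext
      rw [← (hf a).2, ← (hf b).2, hab]
    rw [← Set.image_univ, Set.ncard_image_of_injective _ hinj, Set.ncard_univ] at h1
    simpa using h1

lemma forward {B : Set PermAny} {F : Set PermAny} (hF : F.Finite)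
    (H : ∀ p ∈ AvSet B, ∃ p' ∈ AvSet B, p' ∈ F ∧ TreeIso B p p')
    (r : ∀ n : ℕ, Equiv.Perm (Fin n)) : ∃ n : ℕ, ∃ q : PermAny, IsChild q ⟨n, r n⟩ ∧ q ∉ AvSet B := by
  by_contra hn
  push Not at hn
  obtain ⟨M, hM⟩ := (hF.image (fun p => (Ch B p).ncard)).bddAbove
  obtain ⟨h1, h2⟩ := Ch_large (hn M)
  obtain ⟨p', _, hp', hT⟩ := H _ h1
  have h3 := Ch_card h1 hT
  have h4 := hM (Set.mem_image_of_mem _ hp')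
  simp only at h2 h4
  omega

open Classical in
/-- index of a gap among the active ones. -/
noncomputable def idx (B : Set PermAny) (p : PermAny) (c : ℕ) : ℕ := Nat.count (Active B p) c

lemma idx_inj {B : Set PermAny} {p : PermAny} {c d : ℕ} (hc : Active B p c) (hd : Active B p d)
    (h : idx B p c = idx B p d) : c = d := by
  classical
  exact Nat.count_injective hc hd h

lemma idx_lt {B : Set PermAny} {p : PermAny} {c d : ℕ} (hc : Active B p c) (h : c < d) :
    idx B p c < idx B p d := by
  classical
  exact Nat.count_strict_mono hc h

lemma idx_mono (B : Set PermAny) (p : PermAny) {c d : ℕ} (h : c ≤ d) :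
    idx B p c ≤ idx B p d := by
  classical
  exact Nat.count_monotone _ h

/-- `σ` over `p` corresponds to `σ'` over `p'`. -/
def Cor (B : Set PermAny) (p p' σ σ' : PermAny) : Prop :=
  σ.1 + p'.1 = σ'.1 + p.1 ∧
  (∀ a b, p.1 + a < σ.1 → p.1 + b < σ.1 →
    (pos σ (p.1 + a) < pos σ (p.1 + b) ↔ pos σ' (p'.1 + a) < pos σ' (p'.1 + b))) ∧
  ∀ a, p.1 + a < σ.1 → idx B p (gap p.1 σ (p.1 + a)) = idx B p' (gap p'.1 σ' (p'.1 + a))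

lemma Cor.symm {B : Set PermAny} {p p' σ σ' : PermAny} (h : Cor B p p' σ σ') :
    Cor B p' p σ' σ := by
  obtain ⟨h1, h2, h3⟩ := h
  exact ⟨h1.symm, fun a b ha hb => (h2 a b (by omega) (by omega)).symm,
    fun a ha => (h3 a (by omega)).symm⟩

/-- all gaps of the new values are active. -/
def Act (B : Set PermAny) (p σ : PermAny) : Prop :=
  p.1 ≤ σ.1 ∧ Agree p.1 σ p ∧ ∀ a, p.1 + a < σ.1 → Active B p (gap p.1 σ (p.1 + a))

lemma agree_transfer {B : Set PermAny} {p p' σ σ' τ τ' : PermAny} {n n' : ℕ}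
    (hσ : Cor B p p' σ σ') (hτ : Cor B p p' τ τ') (hσ' : Act B p' σ') (hτ' : Act B p' τ')
    (hA : Agree n σ τ) (hpn : p.1 ≤ n) (hnσ : n ≤ σ.1) (hnτ : n ≤ τ.1) (hn : n + p'.1 = n' + p.1) :
    Agree n' σ' τ' := by
  have hg : ∀ a, p'.1 + a < n' → gap p'.1 σ' (p'.1 + a) = gap p'.1 τ' (p'.1 + a) := by
    intro a ha
    have e1 := hσ.2.2 a (by omega)
    have e2 := hτ.2.2 a (by omega)
    have e3 : gap p.1 σ (p.1 + a) = gap p.1 τ (p.1 + a) := by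
      unfold gap
      congr 1
      apply Finset.filter_congr
      intro x hx
      rw [Finset.mem_range] at hx
      exact hA _ _ (by omega) (by omega)
    have e4 := hσ.1
    have e5 := hτ.1
    apply idx_inj (hσ'.2.2 a (by omega)) (hτ'.2.2 a (by omega))
    rw [← e1, ← e2, e3]
  have hon : ∀ x a, x < p'.1 → p'.1 + a < n' →
      (pos σ' x < pos σ' (p'.1 + a) ↔ pos τ' x < pos τ' (p'.1 + a)) := by
    intro x a hx ha
    rw [gap_iff hσ'.2.1 _ hx, gap_iff hτ'.2.1 _ hx, hg a ha]
  have hne : ∀ (υ : PermAny) x a, x < p'.1 → pos υ x ≠ pos υ (p'.1 + a) := by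
    intro υ x a hx h
    have := pos_inj _ h
    omega
  intro x y hx hy
  rcases lt_or_ge x p'.1 with h1 | h1 <;> rcases lt_or_ge y p'.1 with h2 | h2
  · rw [hσ'.2.1 x y h1 h2, hτ'.2.1 x y h1 h2]
  · obtain ⟨b, rfl⟩ := Nat.exists_eq_add_of_le h2
    exact hon x b h1 hy
  · obtain ⟨a, rfl⟩ := Nat.exists_eq_add_of_le h1
    have := hon y a h2 hx
    have := hne σ' y a h2
    have := hne τ' y a h2
    omega
  · obtain ⟨a, rfl⟩ := Nat.exists_eq_add_of_le h1
    obtain ⟨b, rfl⟩ := Nat.exists_eq_add_of_le h2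
    rw [← hσ.2.1 a b (by omega) (by omega), ← hτ.2.1 a b (by omega) (by omega)]
    exact hA _ _ (by omega) (by omega)

lemma cor_unique {B : Set PermAny} {p p' σ σ' τ' : PermAny}
    (hle : p.1 ≤ σ.1) (hσ : Cor B p p' σ σ') (hτ : Cor B p p' σ τ') (hσ' : Act B p' σ')
    (hτ' : Act B p' τ') : σ' = τ' := by
  have e1 := hσ.1
  have e2 := hτ.1
  apply perm_ext (by omega)
  exact agree_transfer hσ hτ hσ' hτ' (n := σ.1) (fun _ _ _ _ => Iff.rfl) hle le_rfl le_rfl e1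

lemma cor_child {B : Set PermAny} {p p' σ σ' τ τ' : PermAny}
    (hσ : Cor B p p' σ σ') (hτ : Cor B p p' τ τ') (hσ' : Act B p' σ') (hτ' : Act B p' τ')
    (hle : p.1 ≤ σ.1) (h : IsChild τ σ) : IsChild τ' σ' := by
  rw [child_iff] at h ⊢
  have e1 := hσ.1
  have e2 := hτ.1
  refine ⟨by omega, ?_⟩
  exact agree_transfer hτ hσ hτ' hσ' h.2 hle (by omega) le_rfl e1

/-- extend an embedding of new values by the identity on old ones. -/
def ext (m m' : ℕ) (w : ℕ → ℕ) (a : ℕ) : ℕ := if a < m then a else m' + w (a - m)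

lemma ext_old {m : ℕ} (w : ℕ → ℕ) {a : ℕ} (h : a < m) : ext m m w a = a := by simp [ext, h]

lemma ext_new (m : ℕ) (w : ℕ → ℕ) (a : ℕ) : ext m m w (m + a) = m + w a := by simp [ext]

lemma sub_desc {p σ : PermAny} (hle : p.1 ≤ σ.1) (hA : Agree p.1 σ p) {i : ℕ} {w : ℕ → ℕ}
    (hw : ∀ a b, a < b → b < i → w a < w b) (hw2 : ∀ a, a < i → p.1 + w a < σ.1) :
    ∃ ρ : PermAny, ρ.1 = p.1 + i ∧ Emb (ext p.1 p.1 w) ρ σ ∧ Agree p.1 ρ p ∧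
      (∀ a b, a < i → b < i →
        (pos ρ (p.1 + a) < pos ρ (p.1 + b) ↔ pos σ (p.1 + w a) < pos σ (p.1 + w b))) ∧
      ∀ a, a < i → gap p.1 ρ (p.1 + a) = gap p.1 σ (p.1 + w a) := by
  obtain ⟨ρ, h1, h2⟩ := sub_exists σ (p.1 + i) (ext p.1 p.1 w) (by
      intro a b hab hb
      unfold ext
      split_ifs with h1 h2 h2
      · exact hab
      · omega
      · omega
      · have := hw (a - p.1) (b - p.1) (by omega) (by omega)
        omega) (by
      intro a ha
      unfold ext
      split_ifs with h1
      · omega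
      · exact hw2 _ (by omega))
  refine ⟨ρ, h1, h2, ?_, ?_, ?_⟩
  · intro a b ha hb
    rw [h2.2.2 a b (by omega) (by omega), ext_old w ha, ext_old w hb, hA a b ha hb]
  · intro a b ha hb
    rw [h2.2.2 _ _ (by omega) (by omega), ext_new, ext_new]
  · intro a ha
    unfold gap
    congr 1
    apply Finset.filter_congr
    intro x hx
    rw [Finset.mem_range] at hx
    rw [h2.2.2 _ _ (by omega) (by omega), ext_new, ext_old w hx]

lemma act_of_mem {B : Set PermAny} {p σ : PermAny} (h : σ ∈ DSet B p) : Act B p σ := by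
  rw [mem_DSet] at h
  obtain ⟨h1, h2, h3⟩ := h
  refine ⟨h2, h3, fun a ha => ?_⟩
  obtain ⟨ρ, e1, e2, e3, -, e5⟩ := sub_desc h2 h3 (i := 1) (w := fun _ => a)
    (fun _ _ _ _ => by omega) (fun _ _ => ha)
  refine ⟨ρ, av_of_emb e2 h1, (child_iff _ _).2 ⟨e1, e3⟩, ?_⟩
  exact e5 0 (by omega)

/-- transfer of small descendants. -/
def Tr (B : Set PermAny) (k : ℕ) (p p' : PermAny) : Prop :=
  ∀ σ ∈ DSet B p, σ.1 ≤ p.1 + k → ∃ σ' ∈ DSet B p', Cor B p p' σ σ'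

lemma emb_factor {g h : ℕ → ℕ} {b ρ σ : PermAny} (hg : Emb g ρ σ) (hh : Emb h b σ)
    (H : ∀ a, a < b.1 → ∃ c < ρ.1, g c = h a) : ∃ f, Emb f b ρ := by
  have H' : ∀ a, ∃ c, a < b.1 → c < ρ.1 ∧ g c = h a := by
    intro a
    by_cases hb : a < b.1
    · obtain ⟨c, hc⟩ := H a hb
      exact ⟨c, fun _ => hc⟩
    · exact ⟨0, fun h => absurd h hb⟩
  choose f hf using H'
  refine ⟨f, ?_, fun a ha => (hf a ha).1, ?_⟩
  · intro a c hac hc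
    rw [← lt_of_mono hg.1 (hf a (by omega)).1 (hf c hc).1, (hf a (by omega)).2, (hf c hc).2]
    exact hh.1 a c hac hc
  · intro a c ha hc
    rw [hg.2.2 _ _ (hf a ha).1 (hf c hc).1, (hf a ha).2, (hf c hc).2, hh.2.2 a c ha hc]

lemma cor_av {B : Set PermAny} {k : ℕ} (hk : ∀ b ∈ B, b.1 ≤ k) {p p' σ σ' : PermAny}
    (hT : Tr B k p p') (hσ : σ ∈ DSet B p) (hσ' : Act B p' σ') (hC : Cor B p p' σ σ') :
    σ' ∈ AvSet B := by
  intro b hb hcon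
  rw [contains_iff] at hcon
  obtain ⟨h, hh⟩ := hcon
  have hD := mem_DSet.1 hσ
  have e0 := hC.1
  set T : Finset ℕ := (((Finset.range b.1).filter (fun a => p'.1 ≤ h a)).image
    (fun a => h a - p'.1)) with hTdef
  have hTc : T.card ≤ k := by
    refine Finset.card_image_le.trans ((Finset.card_filter_le _ _).trans ?_)
    rw [Finset.card_range]
    exact hk b hb
  obtain ⟨w, hw1, hw2, hw3⟩ := finset_enum T
  have hwT : ∀ x ∈ T, p'.1 + x < σ'.1 := by
    intro x hx
    simp only [hTdef, Finset.mem_image, Finset.mem_filter, Finset.mem_range] at hx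
    obtain ⟨a, ⟨ha, ha2⟩, rfl⟩ := hx
    have := hh.2.1 a ha
    omega
  have hwσ' : ∀ a, a < T.card → p'.1 + w a < σ'.1 := fun a ha => hwT _ (hw2 a ha)
  have hwσ : ∀ a, a < T.card → p.1 + w a < σ.1 := fun a ha => by
    have := hwσ' a ha
    omega
  obtain ⟨ρ, r1, r2, r3, r4, r5⟩ := sub_desc hD.2.1 hD.2.2 hw1 hwσ
  obtain ⟨ρ', s1, s2, s3, s4, s5⟩ := sub_desc hσ'.1 hσ'.2.1 hw1 hwσ'
  have hρ : ρ ∈ DSet B p := mem_DSet.2 ⟨av_of_emb r2 hD.1, by omega, r3⟩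
  obtain ⟨ρ'', hρ'', hC''⟩ := hT ρ hρ (by omega)
  have hC' : Cor B p p' ρ ρ' := by
    refine ⟨by omega, ?_, ?_⟩
    · intro x y hx hy
      rw [r4 x y (by omega) (by omega), s4 x y (by omega) (by omega)]
      exact hC.2.1 _ _ (hwσ x (by omega)) (hwσ y (by omega))
    · intro x hx
      rw [r5 x (by omega), s5 x (by omega)]
      exact hC.2.2 _ (hwσ x (by omega))
  have hA' : Act B p' ρ' := by
    refine ⟨by omega, s3, fun a ha => ?_⟩
    rw [s5 a (by omega)]
    exact hσ'.2.2 _ (hwσ' a (by omega))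
  have heq : ρ'' = ρ' := cor_unique (by omega) hC'' hC' (act_of_mem hρ'') hA'
  have hav : ρ' ∈ AvSet B := heq ▸ hρ''.1
  apply hav b hb
  rw [contains_iff]
  apply emb_factor s2 hh
  intro a ha
  by_cases hap : h a < p'.1
  · exact ⟨h a, by omega, ext_old w hap⟩
  · obtain ⟨i, hi, hi2⟩ := hw3 (h a - p'.1) (by
      simp only [hTdef, Finset.mem_image, Finset.mem_filter, Finset.mem_range]
      exact ⟨a, ⟨ha, by omega⟩, rfl⟩)
    refine ⟨p'.1 + i, by omega, ?_⟩
    rw [ext_new, hi2]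
    omega

lemma cor_exists {B : Set PermAny} {k : ℕ} (hk : ∀ b ∈ B, b.1 ≤ k) (hk1 : 1 ≤ k) {p p' σ : PermAny}
    (hT : Tr B k p p') (hσ : σ ∈ DSet B p) : ∃ σ' ∈ DSet B p', Cor B p p' σ σ' := by
  have hD := mem_DSet.1 hσ
  have hact := act_of_mem hσ
  have hc : ∀ a, ∃ c, p.1 + a < σ.1 → Active B p' c ∧ idx B p (gap p.1 σ (p.1 + a)) = idx B p' c := by
    intro a
    by_cases ha : p.1 + a < σ.1
    · obtain ⟨ρ, e1, e2, e3, -, e5⟩ := sub_desc hD.2.1 hD.2.2 (i := 1) (w := fun _ => a)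
        (fun _ _ _ _ => by omega) (fun _ _ => ha)
      obtain ⟨ρ', h1, h2⟩ := hT ρ (mem_DSet.2 ⟨av_of_emb e2 hD.1, by omega, e3⟩) (by omega)
      have := h2.1
      refine ⟨gap p'.1 ρ' (p'.1 + 0), fun _ => ⟨(act_of_mem h1).2.2 0 (by omega), ?_⟩⟩
      rw [← h2.2.2 0 (by omega), e5 0 (by omega)]
    · exact ⟨0, fun h => absurd h ha⟩
  choose c hc using hc
  have hmono : ∀ a b, p.1 + a < σ.1 → p.1 + b < σ.1 → pos σ (p.1 + a) ≤ pos σ (p.1 + b) →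
      c a ≤ c b := by
    intro a b ha hb hab
    by_contra hlt
    have h1 := idx_lt (hc b hb).1 (not_le.1 hlt)
    have h2 := idx_mono B p (gap_mono p.1 σ hab)
    have h3 := (hc a ha).2
    have h4 := (hc b hb).2
    omega
  set f : ℕ → ℕ ×ₗ ℕ := fun x => if x < p'.1 then toLex (2 * pos p' x + 1, 0)
    else toLex (2 * c (x - p'.1), pos σ (p.1 + (x - p'.1))) with hf
  have fold : ∀ x, x < p'.1 → f x = toLex (2 * pos p' x + 1, 0) := by
    intro x hx; simp [hf, hx]
  have fnew : ∀ a, f (p'.1 + a) = toLex (2 * c a, pos σ (p.1 + a)) := by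
    intro a; simp [hf]
  obtain ⟨σ', h1, h2⟩ := perm_exists (p'.1 + (σ.1 - p.1)) f (by
    intro x y hx hy hxy
    rcases lt_or_ge x p'.1 with h1 | h1 <;> rcases lt_or_ge y p'.1 with h2 | h2
    · rw [fold x h1, fold y h2] at hxy
      simp only [EmbeddingLike.apply_eq_iff_eq, Prod.mk.injEq] at hxy
      exact pos_inj p' (by omega)
    · obtain ⟨b, rfl⟩ := Nat.exists_eq_add_of_le h2
      rw [fold x h1, fnew b] at hxy
      simp only [EmbeddingLike.apply_eq_iff_eq, Prod.mk.injEq] at hxy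
      omega
    · obtain ⟨a, rfl⟩ := Nat.exists_eq_add_of_le h1
      rw [fold y h2, fnew a] at hxy
      simp only [EmbeddingLike.apply_eq_iff_eq, Prod.mk.injEq] at hxy
      omega
    · obtain ⟨a, rfl⟩ := Nat.exists_eq_add_of_le h1
      obtain ⟨b, rfl⟩ := Nat.exists_eq_add_of_le h2
      rw [fnew a, fnew b] at hxy
      simp only [EmbeddingLike.apply_eq_iff_eq, Prod.mk.injEq] at hxy
      have := pos_inj σ hxy.2
      omega)
  have hle := hD.2.1
  have hgap : ∀ a, p.1 + a < σ.1 → gap p'.1 σ' (p'.1 + a) = c a := by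
    intro a ha
    rw [← card_pos p' (hc a ha).1.le]
    unfold gap
    congr 1
    apply Finset.filter_congr
    intro x hx
    rw [Finset.mem_range] at hx
    rw [h2 x _ (by omega) (by omega), fold x hx, fnew a,
      Prod.Lex.toLex_lt_toLex]
    simp only
    omega
  have hAg : Agree p'.1 σ' p' := by
    intro x y hx hy
    rw [h2 x y (by omega) (by omega), fold x hx, fold y hy, Prod.Lex.toLex_lt_toLex]
    simp only
    omega
  have hcor : Cor B p p' σ σ' := by
    refine ⟨by omega, ?_, ?_⟩
    · intro a b ha hb
      rw [h2 _ _ (by omega) (by omega), fnew a, fnew b, Prod.Lex.toLex_lt_toLex]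
      simp only
      have m1 := hmono a b ha hb
      have m2 := hmono b a hb ha
      omega
    · intro a ha
      rw [hgap a ha]
      exact (hc a ha).2
  have hact' : Act B p' σ' := by
    refine ⟨by omega, hAg, fun a ha => ?_⟩
    rw [hgap a (by omega)]
    exact (hc a (by omega)).1
  exact ⟨σ', mem_DSet.2 ⟨cor_av hk hT hσ hact' hcor, by omega, hAg⟩, hcor⟩

lemma treeIso_of_tr {B : Set PermAny} {k : ℕ} (hk : ∀ b ∈ B, b.1 ≤ k) (hk1 : 1 ≤ k)
    {p p' : PermAny} (hp : p ∈ AvSet B) (hp' : p' ∈ AvSet B)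
    (hT : Tr B k p p') (hT' : Tr B k p' p) : TreeIso B p p' := by
  have hex : ∀ σ, ∃ σ', σ ∈ DSet B p → σ' ∈ DSet B p' ∧ Cor B p p' σ σ' := by
    intro σ
    by_cases h : σ ∈ DSet B p
    · obtain ⟨σ', h1, h2⟩ := cor_exists hk hk1 hT h
      exact ⟨σ', fun _ => ⟨h1, h2⟩⟩
    · exact ⟨σ, fun h' => absurd h' h⟩
  choose φ hφ using hex
  refine ⟨φ, ⟨fun σ hσ => (hφ σ hσ).1, ?_, ?_⟩, ?_, ?_⟩
  · intro σ hσ τ hτ h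
    have h1 := (hφ σ hσ).2.symm
    have h2 := (hφ τ hτ).2.symm
    rw [← h] at h2
    exact cor_unique (mem_DSet.1 (hφ σ hσ).1).2.1 h1 h2 (act_of_mem hσ) (act_of_mem hτ)
  · intro σ' hσ'
    obtain ⟨σ, h1, h2⟩ := cor_exists hk hk1 hT' hσ'
    refine ⟨σ, h1, ?_⟩
    exact cor_unique (mem_DSet.1 h1).2.1 (hφ σ h1).2 h2.symm (act_of_mem (hφ σ h1).1)
      (act_of_mem hσ')
  · have hpD : p ∈ DSet B p := mem_DSet.2 ⟨hp, le_rfl, fun _ _ _ _ => Iff.rfl⟩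
    have hpD' : p' ∈ DSet B p' := mem_DSet.2 ⟨hp', le_rfl, fun _ _ _ _ => Iff.rfl⟩
    have hc : Cor B p p' p p' := ⟨by omega, fun a b ha _ => by omega, fun a ha => by omega⟩
    exact cor_unique le_rfl (hφ p hpD).2 hc (act_of_mem (hφ p hpD).1) (act_of_mem hpD')
  · intro τ hτ τ' hτ'
    have h1 := hφ τ hτ
    have h2 := hφ τ' hτ'
    constructor
    · exact cor_child h1.2 h2.2 (act_of_mem h1.1) (act_of_mem h2.1) (mem_DSet.1 hτ).2.1
    · exact cor_child h1.2.symm h2.2.symm (act_of_mem hτ) (act_of_mem hτ') (mem_DSet.1 h1.1).2.1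

/-- the finite data attached to `p`. -/
def Data (B : Set PermAny) (k K : ℕ) (p : PermAny) :
    Set (Fin (k + 1) × (Fin k → Fin k → Prop) × (Fin k → Fin (K + 1))) :=
  {c | ∃ σ ∈ DSet B p, σ.1 = p.1 + c.1 ∧
    (∀ a b : Fin k, (a : ℕ) < c.1 → (b : ℕ) < c.1 →
      (c.2.1 a b ↔ pos σ (p.1 + a) < pos σ (p.1 + b))) ∧
    ∀ a : Fin k, (a : ℕ) < c.1 → (c.2.2 a : ℕ) = idx B p (gap p.1 σ (p.1 + a))}

lemma tr_of_data {B : Set PermAny} {k K : ℕ} (hK : ∀ p : PermAny, ∀ c, Active B p c → idx B p c ≤ K)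
    {p p' : PermAny} (h : Data B k K p = Data B k K p') : Tr B k p p' := by
  intro σ hσ hσk
  have hle := (mem_DSet.1 hσ).2.1
  have hact := act_of_mem hσ
  set c : Fin (k + 1) × (Fin k → Fin k → Prop) × (Fin k → Fin (K + 1)) :=
    (⟨σ.1 - p.1, by omega⟩, fun a b => pos σ (p.1 + a) < pos σ (p.1 + b),
      fun a => if h : p.1 + a < σ.1 then
        ⟨idx B p (gap p.1 σ (p.1 + a)), Nat.lt_succ_of_le (hK _ _ (hact.2.2 a h))⟩ else 0) with hc
  have hmem : c ∈ Data B k K p := by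
    refine ⟨σ, hσ, by simp only [hc]; omega, fun a b _ _ => Iff.rfl, fun a ha => ?_⟩
    simp only [hc] at ha ⊢
    rw [dif_pos (by omega)]
  rw [h] at hmem
  obtain ⟨σ', h1, h2, h3, h4⟩ := hmem
  simp only [hc] at h2 h3 h4
  refine ⟨σ', h1, by omega, ?_, ?_⟩
  · intro a b ha hb
    exact h3 ⟨a, by omega⟩ ⟨b, by omega⟩ (by simp only; omega) (by simp only; omega)
  · intro a ha
    have := h4 ⟨a, by omega⟩ (by simp only; omega)
    rw [dif_pos ha] at this
    exact this

lemma backward {B : Set PermAny} (hB : B.Finite)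
    (h1 : ∃ n : ℕ, ∃ q : PermAny, IsChild q ⟨n, 1⟩ ∧ q ∉ AvSet B)
    (h2 : ∃ n : ℕ, ∃ q : PermAny, IsChild q ⟨n, Fin.revPerm⟩ ∧ q ∉ AvSet B) :
    ∃ F : Set PermAny, F.Finite ∧
      ∀ p ∈ AvSet B, ∃ p' ∈ AvSet B, p' ∈ F ∧ TreeIso B p p' := by
  classical
  obtain ⟨K, hK⟩ := active_bound h1 h2
  have hK' : ∀ p : PermAny, ∀ c, Active B p c → idx B p c ≤ K := by
    intro p c hc
    refine le_trans ?_ (hK p)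
    unfold idx
    rw [Nat.count_eq_card_filter_range]
    have := hc.le
    convert Finset.card_le_card (Finset.filter_subset_filter (Active B p)
      (Finset.range_mono (show c ≤ p.1 + 1 by omega)))
  obtain ⟨k, hk⟩ := (hB.image (fun b => b.1)).bddAbove
  have hk' : ∀ b ∈ B, b.1 ≤ k + 1 := fun b hb => by
    have := hk (Set.mem_image_of_mem _ hb)
    omega
  obtain ⟨F, hF, hbij⟩ := Set.exists_subset_bijOn (AvSet B) (Data B (k + 1) K)
  refine ⟨F, hbij.finite_iff_finite.2 (Set.toFinite _), ?_⟩
  intro p hp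
  obtain ⟨p', hp', he⟩ := hbij.surjOn (Set.mem_image_of_mem _ hp)
  exact ⟨p', hF hp', hp', treeIso_of_tr hk' (by omega) hp (hF hp') (tr_of_data hK' he.symm)
    (tr_of_data hK' he)⟩

end FLGT

/-- For a finitely based class `C = Av(B)`, the rooted-subtree
isomorphism relation `≃` has only finitely many equivalence classes on `C`
(equivalently, `T(B)` is isomorphic to a finitely labeled generating tree) if
and only if some child of an increasing permutation lies outside `C` and some
child of a decreasing permutation lies outside `C`. -/
theorem finitely_labeled_generating_tree_iff (B : Set PermAny) (hB : B.Finite) :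
    (∃ F : Set PermAny, F.Finite ∧
      ∀ p ∈ AvSet B, ∃ p' ∈ AvSet B, p' ∈ F ∧ TreeIso B p p') ↔
    ((∃ n : ℕ, ∃ q : PermAny, IsChild q ⟨n, 1⟩ ∧ q ∉ AvSet B) ∧
     (∃ n : ℕ, ∃ q : PermAny, IsChild q ⟨n, Fin.revPerm⟩ ∧ q ∉ AvSet B)) := by
  constructor
  · rintro ⟨F, hF, H⟩
    exact ⟨FLGT.forward hF H (fun _ => 1), FLGT.forward hF H (fun _ => Fin.revPerm)⟩
  · rintro ⟨h1, h2⟩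
    exact FLGT.backward hB h1 h2
end
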